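/- arXiv:1808.07508 — 4 statements merged into one kernel-verified Lean document; each statement's English description precedes it below -/
import Mathlib

section
/- Let $R$ be a commutative noetherian local ring and $(A \xrightarrow{f} B)$ a monomorphism of finitely generated $R$-modules with cokernel $C$. Then there is an exact sequence $0 \to \mathrm{Hom}_R(C,R) \to \mathrm{Hom}_R(B,R) \xrightarrow{f^*} \mathrm{Hom}_R(A,R) \to \mathrm{Tr}\,C \to \mathrm{Tr}\,B \oplus Q \to \mathrm{Tr}\,A \to 0$ for some finitely generated projective $R$-module $Q$. -/
open LinearMap Function

/-- A bundled module over a ring `S`. -/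
structure Mdl (S : Type) [Ring S] : Type 1 where
  carrier : Type
  [ag : AddCommGroup carrier]
  [mod : Module S carrier]

attribute [instance] Mdl.ag Mdl.mod

instance {S : Type} [Ring S] : CoeSort (Mdl S) Type := ⟨Mdl.carrier⟩

/-- Bundle a module. -/
def Mdl.of (S : Type) [Ring S] (M : Type) [AddCommGroup M] [Module S M] : Mdl S := ⟨M⟩

section RingDefs

variable {S : Type} [Ring S]

/-- finitely generated projective -/
def FGProj (P : Mdl S) : Prop := Module.Projective S P.carrier ∧ Module.Finite S P.carrier

/-- superfluous (small) submodule -/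
def Superfluous {P : Type} [AddCommGroup P] [Module S P] (K : Submodule S P) : Prop :=
  ∀ N : Submodule S P, N ⊔ K = ⊤ → N = ⊤

/-- projective cover of a module -/
def IsProjCover {P M : Mdl S} (p : P.carrier →ₗ[S] M.carrier) : Prop :=
  FGProj P ∧ Function.Surjective p ∧ Superfluous (LinearMap.ker p)

/-- `N` is a (minimal) first syzygy of `M`. -/
def IsSyz1 (M N : Mdl S) : Prop :=
  ∃ (P : Mdl S) (p : P.carrier →ₗ[S] M.carrier),
    IsProjCover p ∧ Nonempty (N.carrier ≃ₗ[S] LinearMap.ker p)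

/-- `N` is an `n`-th (minimal) syzygy of `M`. -/
def IsSyz (n : ℕ) (M N : Mdl S) : Prop :=
  ∃ F : Fin (n + 1) → Mdl S,
    Nonempty ((F 0).carrier ≃ₗ[S] M.carrier) ∧
    Nonempty ((F (Fin.last n)).carrier ≃ₗ[S] N.carrier) ∧
    ∀ i : Fin n, IsSyz1 (F i.castSucc) (F i.succ)

/-- Gorenstein projective: a syzygy of a totally acyclic complex of
finitely generated projectives. -/
def IsGP (M : Mdl S) : Prop :=
  ∃ (P : ℤ → Mdl S) (d : ∀ i : ℤ, (P (i + 1)).carrier →ₗ[S] (P i).carrier),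
    (∀ i, FGProj (P i)) ∧
    (∀ i, LinearMap.range (d (i + 1)) = LinearMap.ker (d i)) ∧
    (∀ (Q : Mdl S), Module.Projective S Q.carrier →
      ∀ (i : ℤ) (g : (P (i + 1)).carrier →ₗ[S] Q.carrier), g ∘ₗ d (i + 1) = 0 →
        ∃ h : (P i).carrier →ₗ[S] Q.carrier, h ∘ₗ d i = g) ∧
    Nonempty (M.carrier ≃ₗ[S] LinearMap.ker (d 0))

/-- a map factoring through a projective module -/
def FactorsThruProj {A B : Mdl S} (φ : A.carrier →ₗ[S] B.carrier) : Prop :=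
  ∃ (Q : Mdl S) (α : A.carrier →ₗ[S] Q.carrier) (β : Q.carrier →ₗ[S] B.carrier),
    Module.Projective S Q.carrier ∧ β ∘ₗ α = φ

/-- `M` is stable: it has no nonzero projective direct summand. -/
def NoProjSummand (M : Mdl S) : Prop :=
  ∀ N Q : Mdl S, Nonempty (M.carrier ≃ₗ[S] (N.carrier × Q.carrier)) →
    Module.Projective S Q.carrier → Subsingleton Q.carrier

/-- indecomposable module -/
def IndecMod (M : Mdl S) : Prop :=
  Nontrivial M.carrier ∧
  ∀ N Q : Mdl S, Nonempty (M.carrier ≃ₗ[S] (N.carrier × Q.carrier)) →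
    Subsingleton N.carrier ∨ Subsingleton Q.carrier

end RingDefs
section MorCat

variable {R : Type} [CommRing R]

/-- An object of the morphism category `𝓜`. -/
structure MObj (R : Type) [CommRing R] : Type 1 where
  dom : Mdl R
  cod : Mdl R
  map : dom.carrier →ₗ[R] cod.carrier

/-- A morphism in the morphism category: a commutative square. -/
structure MHom (f g : MObj R) : Type where
  h1 : f.dom.carrier →ₗ[R] g.dom.carrier
  h2 : f.cod.carrier →ₗ[R] g.cod.carrier
  comm : g.map ∘ₗ h1 = h2 ∘ₗ f.map

/-- isomorphism in the morphism category -/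
def MIso (f g : MObj R) : Prop :=
  ∃ (e1 : f.dom.carrier ≃ₗ[R] g.dom.carrier) (e2 : f.cod.carrier ≃ₗ[R] g.cod.carrier),
    g.map ∘ₗ (e1 : f.dom.carrier →ₗ[R] g.dom.carrier)
      = (e2 : f.cod.carrier →ₗ[R] g.cod.carrier) ∘ₗ f.map

/-- epimorphism in the morphism category (componentwise surjective) -/
def MEpi {f g : MObj R} (φ : MHom f g) : Prop :=
  Function.Surjective φ.h1 ∧ Function.Surjective φ.h2

/-- projective object of the morphism category -/
def MProj (f : MObj R) : Prop :=
  ∀ (g h : MObj R) (e : MHom g h), MEpi e → ∀ φ : MHom f h,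
    ∃ ψ : MHom f g, e.h1 ∘ₗ ψ.h1 = φ.h1 ∧ e.h2 ∘ₗ ψ.h2 = φ.h2

/-- projective cover in the morphism category: a right minimal epimorphism
from a projective object -/
def MProjCover {q f : MObj R} (φ : MHom q f) : Prop :=
  MProj q ∧ MEpi φ ∧
  ∀ ξ : MHom q q, φ.h1 ∘ₗ ξ.h1 = φ.h1 → φ.h2 ∘ₗ ξ.h2 = φ.h2 →
    Function.Bijective ξ.h1 ∧ Function.Bijective ξ.h2

/-- `g` is a first syzygy of `f` in the morphism category. -/
def MSyz1 (f g : MObj R) : Prop :=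
  ∃ (q : MObj R) (φ : MHom q f), MProjCover φ ∧
    ∃ k : (LinearMap.ker φ.h1 : Type) →ₗ[R] (LinearMap.ker φ.h2 : Type),
      (LinearMap.ker φ.h2).subtype ∘ₗ k = q.map ∘ₗ (LinearMap.ker φ.h1).subtype ∧
      MIso g ⟨Mdl.of R (LinearMap.ker φ.h1), Mdl.of R (LinearMap.ker φ.h2), k⟩

/-- `g` is an `n`-th syzygy of `f` in the morphism category. -/
def MSyz (n : ℕ) (f g : MObj R) : Prop :=
  ∃ F : Fin (n + 1) → MObj R,
    MIso (F 0) f ∧ MIso (F (Fin.last n)) g ∧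
    ∀ i : Fin n, MSyz1 (F i.castSucc) (F i.succ)

/-- `g` is the induced map on (minimal) first syzygies of the map `f`. -/
def MapSyz1 (f g : MObj R) : Prop :=
  ∃ (PA PB : Mdl R) (pA : PA.carrier →ₗ[R] f.dom.carrier)
    (pB : PB.carrier →ₗ[R] f.cod.carrier) (L : PA.carrier →ₗ[R] PB.carrier),
    IsProjCover pA ∧ IsProjCover pB ∧ f.map ∘ₗ pA = pB ∘ₗ L ∧
    ∃ k : (LinearMap.ker pA : Type) →ₗ[R] (LinearMap.ker pB : Type),
      (LinearMap.ker pB).subtype ∘ₗ k = L ∘ₗ (LinearMap.ker pA).subtype ∧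
      MIso g ⟨Mdl.of R (LinearMap.ker pA), Mdl.of R (LinearMap.ker pB), k⟩

/-- `g` is the induced map on minimal `n`-th syzygies of the map `f`. -/
def MapSyz (n : ℕ) (f g : MObj R) : Prop :=
  ∃ F : Fin (n + 1) → MObj R,
    MIso (F 0) f ∧ MIso (F (Fin.last n)) g ∧
    ∀ i : Fin n, MapSyz1 (F i.castSucc) (F i.succ)

/-- direct sum in the morphism category -/
def DSum (f g : MObj R) : MObj R :=
  ⟨Mdl.of R (f.dom.carrier × g.dom.carrier), Mdl.of R (f.cod.carrier × g.cod.carrier),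
    f.map.prodMap g.map⟩

/-- the zero object, up to iso -/
def MTrivial (f : MObj R) : Prop := Subsingleton f.dom.carrier ∧ Subsingleton f.cod.carrier

/-- indecomposable object of the morphism category -/
def MIndec (f : MObj R) : Prop :=
  ¬ MTrivial f ∧ ∀ g h : MObj R, MIso f (DSum g h) → MTrivial g ∨ MTrivial h

/-- the endomorphism ring of `f` in the morphism category is local -/
def MEndLocal (f : MObj R) : Prop :=
  ¬ MTrivial f ∧
  ∀ ξ : MHom f f,
    (Function.Bijective ξ.h1 ∧ Function.Bijective ξ.h2) ∨
    (Function.Bijective ((LinearMap.id : f.dom.carrier →ₗ[R] f.dom.carrier) - ξ.h1) ∧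
     Function.Bijective ((LinearMap.id : f.cod.carrier →ₗ[R] f.cod.carrier) - ξ.h2))

/-- no nonzero projective direct summand in the morphism category -/
def MNoProjSummand (f : MObj R) : Prop :=
  ∀ g q : MObj R, MIso f (DSum g q) → MProj q → MTrivial q

/-- the cokernel module of an object -/
def CokMod (f : MObj R) : Mdl R := Mdl.of R (f.cod.carrier ⧸ LinearMap.range f.map)

/-- the cokernel object `Cok(f) : B → Cok f` -/
def CokObj (f : MObj R) : MObj R := ⟨f.cod, CokMod f, (LinearMap.range f.map).mkQ⟩

/-- Gorenstein projective objects of the morphism category -/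
def InG (f : MObj R) : Prop :=
  Function.Injective f.map ∧ IsGP f.dom ∧ IsGP (CokMod f)

/-- objects of `𝓗`: morphisms between Gorenstein projective modules -/
def InH (f : MObj R) : Prop := IsGP f.dom ∧ IsGP f.cod

/-- objects of `𝓔`: epimorphisms between Gorenstein projective modules -/
def InE (f : MObj R) : Prop := InH f ∧ Function.Surjective f.map

/-- `𝓖`-precover -/
def IsGPrecover {g x : MObj R} (φ : MHom g x) : Prop :=
  InG g ∧ ∀ g' : MObj R, InG g' → ∀ ψ : MHom g' x,
    ∃ ξ : MHom g' g, φ.h1 ∘ₗ ξ.h1 = ψ.h1 ∧ φ.h2 ∘ₗ ξ.h2 = ψ.h2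

/-- right minimal morphism -/
def MRightMin {g x : MObj R} (φ : MHom g x) : Prop :=
  ∀ ξ : MHom g g, φ.h1 ∘ₗ ξ.h1 = φ.h1 → φ.h2 ∘ₗ ξ.h2 = φ.h2 →
    Function.Bijective ξ.h1 ∧ Function.Bijective ξ.h2

/-- `𝓖`-cover -/
def IsGCover {g x : MObj R} (φ : MHom g x) : Prop := IsGPrecover φ ∧ MRightMin φ

/-- `𝓔`-preenvelope -/
def IsEPreenvelope {x e : MObj R} (φ : MHom x e) : Prop :=
  InE e ∧ ∀ e' : MObj R, InE e' → ∀ ψ : MHom x e',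
    ∃ ξ : MHom e e', ξ.h1 ∘ₗ φ.h1 = ψ.h1 ∧ ξ.h2 ∘ₗ φ.h2 = ψ.h2

/-- left minimal morphism -/
def MLeftMin {x e : MObj R} (φ : MHom x e) : Prop :=
  ∀ ξ : MHom e e, ξ.h1 ∘ₗ φ.h1 = φ.h1 → ξ.h2 ∘ₗ φ.h2 = φ.h2 →
    Function.Bijective ξ.h1 ∧ Function.Bijective ξ.h2

/-- `𝓔`-envelope -/
def IsEEnvelope {x e : MObj R} (φ : MHom x e) : Prop := IsEPreenvelope φ ∧ MLeftMin φ

/-- injective objects of `𝓗`: sums of `(P → P)` and `(P → 0)`,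
i.e. objects isomorphic to a projection `P × P' → P`. -/
def HInj (q : MObj R) : Prop :=
  ∃ P P' : Mdl R, FGProj P ∧ FGProj P' ∧
    MIso q ⟨Mdl.of R (P.carrier × P'.carrier), P, LinearMap.fst R P.carrier P'.carrier⟩

/-- no nonzero `𝓗`-injective direct summand -/
def MNoHInjSummand (f : MObj R) : Prop :=
  ∀ g q : MObj R, MIso f (DSum g q) → HInj q → MTrivial q

/-- `s` is (isomorphic to) the reduced `𝓖`-cover of `x` -/
def IsRedGCover (s x : MObj R) : Prop :=
  ∃ (g : MObj R) (φ : MHom g x), IsGCover φ ∧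
    ∃ q : MObj R, MProj q ∧ MIso g (DSum s q) ∧ MNoProjSummand s

/-- `s` is (isomorphic to) the reduced `𝓔`-envelope of `x` -/
def IsRedEEnvelope (s x : MObj R) : Prop :=
  ∃ (e : MObj R) (φ : MHom x e), IsEEnvelope φ ∧
    ∃ q : MObj R, HInj q ∧ MIso e (DSum s q) ∧ MNoHInjSummand s

/-- Auslander transpose of a module -/
def IsTranspose (M T : Mdl R) : Prop :=
  ∃ (P1 P0 : Mdl R) (d : P1.carrier →ₗ[R] P0.carrier) (p : P0.carrier →ₗ[R] M.carrier),
    FGProj P1 ∧ FGProj P0 ∧ Function.Surjective p ∧ Superfluous (LinearMap.ker p) ∧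
    LinearMap.range d = LinearMap.ker p ∧ Superfluous (LinearMap.ker d) ∧
    Nonempty (T.carrier ≃ₗ[R] (Module.Dual R P1.carrier ⧸ LinearMap.range d.dualMap))

/-- `L` is `λ M = Ω¹ Tr M`. -/
def LambdaOf (M L : Mdl R) : Prop := ∃ T : Mdl R, IsTranspose M T ∧ IsSyz1 T L

/-- horizontally linked module -/
def HorLinkedMod (M : Mdl R) : Prop :=
  ∃ L L2 : Mdl R, LambdaOf M L ∧ LambdaOf L L2 ∧ Nonempty (M.carrier ≃ₗ[R] L2.carrier)

/-- the Auslander transpose in the morphism category, computed by dualizing a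
(componentwise) minimal projective presentation
`(P₁ → P₁ ⊕ Q₁) → (P₀ → P₀ ⊕ Q₀) → f → 0` in `𝓜` against `𝐫 = (R → R ⊕ R)`. -/
def IsMTranspose (f t : MObj R) : Prop :=
  ∃ (P1 Q1 P0 Q0 : Mdl R)
    (u : P1.carrier →ₗ[R] P0.carrier)
    (v : (P1.carrier × Q1.carrier) →ₗ[R] (P0.carrier × Q0.carrier))
    (p : P0.carrier →ₗ[R] f.dom.carrier)
    (q : (P0.carrier × Q0.carrier) →ₗ[R] f.cod.carrier),
    FGProj P1 ∧ FGProj Q1 ∧ FGProj P0 ∧ FGProj Q0 ∧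
    v ∘ₗ LinearMap.inl R P1.carrier Q1.carrier = LinearMap.inl R P0.carrier Q0.carrier ∘ₗ u ∧
    q ∘ₗ LinearMap.inl R P0.carrier Q0.carrier = f.map ∘ₗ p ∧
    Function.Surjective p ∧ Function.Surjective q ∧
    Superfluous (LinearMap.ker p) ∧ Superfluous (LinearMap.ker q) ∧
    LinearMap.range u = LinearMap.ker p ∧ LinearMap.range v = LinearMap.ker q ∧
    Superfluous (LinearMap.ker u) ∧ Superfluous (LinearMap.ker v) ∧
    ∃ (e1 : t.dom.carrier ≃ₗ[R]
        (Module.Dual R Q1.carrier ⧸ LinearMap.range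
          (LinearMap.snd R P0.carrier Q0.carrier ∘ₗ v ∘ₗ
            LinearMap.inr R P1.carrier Q1.carrier).dualMap))
      (e2 : t.cod.carrier ≃ₗ[R]
        (Module.Dual R (P1.carrier × Q1.carrier) ⧸ LinearMap.range v.dualMap))
      (tt : (Module.Dual R Q1.carrier ⧸ LinearMap.range
          (LinearMap.snd R P0.carrier Q0.carrier ∘ₗ v ∘ₗ
            LinearMap.inr R P1.carrier Q1.carrier).dualMap) →ₗ[R]
        (Module.Dual R (P1.carrier × Q1.carrier) ⧸ LinearMap.range v.dualMap)),
      tt ∘ₗ (LinearMap.range (LinearMap.snd R P0.carrier Q0.carrier ∘ₗ v ∘ₗ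
          LinearMap.inr R P1.carrier Q1.carrier).dualMap).mkQ
        = (LinearMap.range v.dualMap).mkQ ∘ₗ (LinearMap.snd R P1.carrier Q1.carrier).dualMap ∧
      (e2 : t.cod.carrier →ₗ[R] _) ∘ₗ t.map = tt ∘ₗ (e1 : t.dom.carrier →ₗ[R] _)

/-- `g ≅ λ_𝓜 f = Ω¹_𝓜 Tr_𝓜 f` -/
def MLambda (f g : MObj R) : Prop := ∃ t : MObj R, IsMTranspose f t ∧ MSyz1 t g

/-- horizontally linked object of the submodule category -/
def MHorLinked (f : MObj R) : Prop :=
  ∃ g h : MObj R, MLambda f g ∧ MLambda g h ∧ MIso f h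

/-- the dual object `(B' → A')` of `(A → B)` -/
def DualObj (f : MObj R) : MObj R :=
  ⟨Mdl.of R (Module.Dual R f.cod.carrier), Mdl.of R (Module.Dual R f.dom.carrier), f.map.dualMap⟩

/-- componentwise short exact sequence in the morphism category -/
def MShortExact {a b c : MObj R} (φ : MHom a b) (ψ : MHom b c) : Prop :=
  Function.Injective φ.h1 ∧ Function.Injective φ.h2 ∧
  Function.Surjective ψ.h1 ∧ Function.Surjective ψ.h2 ∧
  LinearMap.range φ.h1 = LinearMap.ker ψ.h1 ∧
  LinearMap.range φ.h2 = LinearMap.ker ψ.h2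

/-- split monomorphism -/
def MSplitMono {a b : MObj R} (φ : MHom a b) : Prop :=
  ∃ σ : MHom b a, σ.h1 ∘ₗ φ.h1 = LinearMap.id ∧ σ.h2 ∘ₗ φ.h2 = LinearMap.id

/-- split epimorphism -/
def MSplitEpi {x c : MObj R} (θ : MHom x c) : Prop :=
  ∃ σ : MHom c x, θ.h1 ∘ₗ σ.h1 = LinearMap.id ∧ θ.h2 ∘ₗ σ.h2 = LinearMap.id

/-- almost split sequence in a full subcategory `C` of the morphism category -/
def IsAlmostSplitIn (C : MObj R → Prop) {a b c : MObj R}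
    (φ : MHom a b) (ψ : MHom b c) : Prop :=
  C a ∧ C b ∧ C c ∧ MShortExact φ ψ ∧ ¬ MSplitMono φ ∧ MEndLocal a ∧
  ∀ x : MObj R, C x → ∀ θ : MHom x c, ¬ MSplitEpi θ →
    ∃ ρ : MHom x b, ψ.h1 ∘ₗ ρ.h1 = θ.h1 ∧ ψ.h2 ∘ₗ ρ.h2 = θ.h2

end MorCat

/-- A Gorenstein local ring: noetherian local, and some fixed syzygy functor lands in
Gorenstein projective (maximal Cohen-Macaulay) modules. -/
def IsGorensteinLocal (R : Type) [CommRing R] : Prop :=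
  IsNoetherianRing R ∧ IsLocalRing R ∧
  ∃ n : ℕ, ∀ M : Mdl R, Module.Finite R M.carrier → ∀ N : Mdl R, IsSyz n M N → IsGP N

section Covers

variable {R : Type} [CommRing R]

lemma Superfluous.map_inl {P K : Type} [AddCommGroup P] [Module R P] [AddCommGroup K] [Module R K]
    {L : Submodule R P} (hL : Superfluous L) :
    Superfluous (L.map (LinearMap.inl R P K)) := by
  intro N hN
  have h : N.comap (LinearMap.inl R P K) = ⊤ := by
    refine hL _ (eq_top_iff.2 fun x _ => ?_)
    obtain ⟨n, hn, _, ⟨l, hl, rfl⟩, h⟩ := Submodule.mem_sup.1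
      (hN ▸ Submodule.mem_top : LinearMap.inl R P K x ∈ N ⊔ L.map (LinearMap.inl R P K))
    refine Submodule.mem_sup.2 ⟨x - l, ?_, l, hl, sub_add_cancel x l⟩
    rwa [Submodule.mem_comap, map_sub, ← h, add_sub_cancel_right]
  rwa [sup_eq_left.2 (Submodule.map_le_iff_le_comap.2 (h ▸ le_top))] at hN

lemma Superfluous.ker_prodMap_id {P M K : Type} [AddCommGroup P] [Module R P] [AddCommGroup M]
    [Module R M] [AddCommGroup K] [Module R K] {d : P →ₗ[R] M} (hd : Superfluous (ker d)) :
    Superfluous (ker (d.prodMap (LinearMap.id : K →ₗ[R] K))) := by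
  convert hd.map_inl (K := K)
  ext ⟨x, k⟩
  simp [eq_comm]

/-- Over a local ring, every finitely generated module has a finite free projective cover. -/
lemma exists_superfluous_ker [IsLocalRing R] (M : Type) [AddCommGroup M] [Module R M]
    [Module.Finite R M] :
    ∃ (n : ℕ) (p : (Fin n → R) →ₗ[R] M), Surjective p ∧ Superfluous (ker p) := by
  let k := IsLocalRing.ResidueField R
  let b := Module.finBasis k (TensorProduct R k M)
  choose v hv using fun i =>
    TensorProduct.mk_surjective R M k IsLocalRing.residue_surjective (b i)
  refine ⟨_, Fintype.linearCombination R v, ?_, fun N hN => ?_⟩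
  · rw [← LinearMap.range_eq_top, Fintype.range_linearCombination,
      IsLocalRing.span_eq_top_of_tmul_eq_basis v b hv]
  have hker : ker (Fintype.linearCombination R v) ≤ IsLocalRing.maximalIdeal R • ⊤ := by
    intro x hx
    have hx' : ∑ i, IsLocalRing.residue R (x i) • b i = 0 := by
      have := congrArg (TensorProduct.mk R k M 1) (LinearMap.mem_ker.1 hx)
      rw [Fintype.linearCombination_apply, map_sum, map_zero] at this
      rw [← this]
      refine Finset.sum_congr rfl fun i _ => ?_
      rw [map_smul, hv]
      exact algebraMap_smul k (x i) (b i)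
    have h0 := Fintype.linearIndependent_iff.1 b.linearIndependent _ hx'
    rw [← (Pi.basisFun R _).sum_repr x]
    refine Submodule.sum_mem _ fun i _ => Submodule.smul_mem_smul ?_ Submodule.mem_top
    simpa using (IsLocalRing.residue_eq_zero_iff _).1 (h0 i)
  refine top_le_iff.1 (Submodule.le_of_le_smul_of_le_jacobson_bot Module.Finite.fg_top
    (IsLocalRing.maximalIdeal_le_jacobson ⊥) ?_)
  rw [← hN]
  exact sup_le_sup_left (hN.symm ▸ hker) N

/-- Over a noetherian local ring, every finitely generated module has a finite free minimal
presentation. -/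
lemma exists_minimal_presentation [IsNoetherianRing R] [IsLocalRing R] (M : Type)
    [AddCommGroup M] [Module R M] [Module.Finite R M] :
    ∃ (m n : ℕ) (d : (Fin m → R) →ₗ[R] Fin n → R) (p : (Fin n → R) →ₗ[R] M), Surjective p ∧
      Superfluous (ker p) ∧ range d = ker p ∧ Superfluous (ker d) := by
  obtain ⟨n, p, hp, hp'⟩ := exists_superfluous_ker (R := R) M
  obtain ⟨m, d, hd, hd'⟩ := exists_superfluous_ker (R := R) (ker p)
  refine ⟨m, n, (ker p).subtype ∘ₗ d, p, hp, hp', ?_, ?_⟩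
  · rw [range_comp_of_range_eq_top _ (range_eq_top.2 hd), Submodule.range_subtype]
  · rwa [ker_comp_of_ker_eq_bot _ (ker p).ker_subtype]

lemma fgProj_of (P : Type) [AddCommGroup P] [Module R P] [hP : Module.Projective R P]
    [hf : Module.Finite R P] : FGProj (Mdl.of R P) :=
  ⟨hP, hf⟩

lemma isTranspose_of {M : Mdl R} {m n : ℕ} {d : (Fin m → R) →ₗ[R] Fin n → R}
    {p : (Fin n → R) →ₗ[R] M.carrier} (hp : Surjective p) (hp' : Superfluous (ker p))
    (hd : range d = ker p) (hd' : Superfluous (ker d)) :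
    IsTranspose M (Mdl.of R (Module.Dual R (Fin m → R) ⧸ range d.dualMap)) :=
  ⟨Mdl.of R (Fin m → R), Mdl.of R (Fin n → R), d, p, fgProj_of _, fgProj_of _, hp, hp', hd, hd',
    ⟨LinearEquiv.refl R _⟩⟩

/-- The horseshoe lemma for projective presentations. -/
lemma exists_horseshoe {P₁ P₀ Q₁ Q₀ A B C : Type} [AddCommGroup P₁] [Module R P₁]
    [AddCommGroup P₀] [Module R P₀] [AddCommGroup Q₁] [Module R Q₁] [AddCommGroup Q₀] [Module R Q₀]
    [AddCommGroup A] [Module R A] [AddCommGroup B] [Module R B] [AddCommGroup C] [Module R C]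
    [Module.Projective R Q₁] [Module.Projective R Q₀]
    {f : A →ₗ[R] B} {g : B →ₗ[R] C} (hf : Injective f) (hg : Surjective g) (hfg : Exact f g)
    {dA : P₁ →ₗ[R] P₀} {pA : P₀ →ₗ[R] A} (hpA : Surjective pA) (hdA : range dA = ker pA)
    {dC : Q₁ →ₗ[R] Q₀} {pC : Q₀ →ₗ[R] C} (hpC : Surjective pC) (hdC : range dC = ker pC) :
    ∃ (v : P₁ × Q₁ →ₗ[R] P₀ × Q₀) (q : P₀ × Q₀ →ₗ[R] B),
      Surjective q ∧ range v = ker q ∧ q ∘ₗ inl R P₀ Q₀ = f ∘ₗ pA ∧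
      v ∘ₗ inl R P₁ Q₁ = inl R P₀ Q₀ ∘ₗ dA ∧ snd R P₀ Q₀ ∘ₗ v = dC ∘ₗ snd R P₁ Q₁ := by
  obtain ⟨s, hs⟩ := Module.projective_lifting_property g pC hg
  have hs' (x) : g (s x) = pC x := LinearMap.congr_fun hs x
  have hdA' (x) : pA (dA x) = 0 := hdA.le (dA.mem_range_self x)
  have hdC' (x) : pC (dC x) = 0 := hdC.le (dC.mem_range_self x)
  have hmem (y : Q₁) : -s (dC y) ∈ range f := by
    rw [← hfg.linearMap_ker_eq, LinearMap.mem_ker, map_neg, hs', hdC', neg_zero]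
  obtain ⟨h, hh⟩ := Module.projective_lifting_property (f ∘ₗ pA).rangeRestrict
    ((-(s ∘ₗ dC)).codRestrict (range (f ∘ₗ pA)) fun y => by
      rw [range_comp_of_range_eq_top _ (range_eq_top.2 hpA)]; exact hmem y)
    (f ∘ₗ pA).surjective_rangeRestrict
  have hh' (y) : f (pA (h y)) = -s (dC y) := congrArg Subtype.val (LinearMap.congr_fun hh y)
  refine ⟨(dA.coprod h).prod (dC ∘ₗ snd R P₁ Q₁), (f ∘ₗ pA).coprod s, fun b => ?_, ?_, ?_, ?_, ?_⟩
  · obtain ⟨y, hy⟩ := hpC (g b)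
    obtain ⟨a, ha⟩ := (hfg (b - s y)).1 (by rw [map_sub, hs', hy, sub_self])
    obtain ⟨x, rfl⟩ := hpA a
    exact ⟨(x, y), by simp [ha]⟩
  · ext ⟨x, y⟩
    constructor
    · rintro ⟨⟨x', y'⟩, hxy⟩
      obtain ⟨rfl, rfl⟩ := Prod.ext_iff.1 hxy
      simp [hdA', hh']
    · intro hxy
      have hxy : f (pA x) + s y = 0 := hxy
      obtain ⟨y', rfl⟩ : y ∈ range dC := by
        rw [hdC, LinearMap.mem_ker, ← hs', eq_neg_of_add_eq_zero_right hxy, map_neg,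
          hfg.apply_apply_eq_zero, neg_zero]
      obtain ⟨x', hx'⟩ : x - h y' ∈ range dA := by
        rw [hdA, LinearMap.mem_ker]
        apply hf
        rw [map_sub, map_sub, hh', sub_neg_eq_add, hxy, map_zero]
      exact ⟨(x', y'), by simp [hx']⟩
  all_goals ext <;> simp

/-- A map from a projective module onto the range of a projective cover factors through the
projection onto a direct summand isomorphic to the cover. -/
lemma exists_equiv_prod_of_range_eq {P F M : Type} [AddCommGroup P] [Module R P]
    [AddCommGroup F] [Module R F] [AddCommGroup M] [Module R M] [Module.Projective R P]
    [Module.Projective R F] (p : P →ₗ[R] M) (q : F →ₗ[R] M) (hp : Superfluous (ker p))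
    (h : range p = range q) :
    ∃ (K : Submodule R F) (e : F ≃ₗ[R] P × K), ∀ x, p (e x).1 = q x := by
  obtain ⟨a, ha⟩ := Module.projective_lifting_property p.rangeRestrict
    (q.codRestrict (range p) fun x => h ▸ q.mem_range_self x) p.surjective_rangeRestrict
  have hpa (x) : p (a x) = q x := congrArg Subtype.val (LinearMap.congr_fun ha x)
  have hsurj : range a = ⊤ := hp _ <| eq_top_iff.2 fun y _ => by
    obtain ⟨x, hx⟩ : p y ∈ range q := h ▸ p.mem_range_self y
    refine Submodule.mem_sup.2 ⟨a x, a.mem_range_self x, y - a x, ?_, add_sub_cancel _ _⟩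
    rw [LinearMap.mem_ker, map_sub, hpa, hx, sub_self]
  obtain ⟨s, hs⟩ := a.exists_rightInverse_of_surjective hsurj
  have hs' (y) : a (s y) = y := LinearMap.congr_fun hs y
  refine ⟨ker a, LinearEquiv.ofLinearMap
    (a.prod ((LinearMap.id - s ∘ₗ a).codRestrict (ker a) fun x => by simp [hs']))
    (s.coprod (ker a).subtype) ?_ ?_, hpa⟩
  · ext <;> simp [hs']
  · ext; simp

/-- The cokernel of the dual of an arbitrary projective presentation differs from that of a
minimal one by a projective direct summand. -/
lemma exists_dual_coker_equiv {M₁ M₀ F₁ F₀ B : Type} [AddCommGroup M₁] [Module R M₁]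
    [AddCommGroup M₀] [Module R M₀] [AddCommGroup F₁] [Module R F₁] [AddCommGroup F₀] [Module R F₀]
    [AddCommGroup B] [Module R B] [Module.Projective R M₁] [Module.Projective R M₀]
    [Module.Projective R F₁] [Module.Projective R F₀]
    {d : M₁ →ₗ[R] M₀} {p : M₀ →ₗ[R] B} {v : F₁ →ₗ[R] F₀} {q : F₀ →ₗ[R] B}
    (hp : Surjective p) (hq : Surjective q) (hd : range d = ker p) (hv : range v = ker q)
    (hp' : Superfluous (ker p)) (hd' : Superfluous (ker d)) :
    ∃ K : Submodule R F₁, Module.Projective R K ∧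
      Nonempty ((Module.Dual R F₁ ⧸ range v.dualMap) ≃ₗ[R]
        (Module.Dual R M₁ ⧸ range d.dualMap) × Module.Dual R K) := by
  obtain ⟨K₀, e₀, he₀⟩ := exists_equiv_prod_of_range_eq p q hp'
    (by rw [range_eq_top.2 hp, range_eq_top.2 hq])
  have hK₀ : Module.Projective R K₀ :=
    .of_split (e₀.symm.toLinearMap ∘ₗ inr R M₀ K₀) (snd R M₀ K₀ ∘ₗ e₀.toLinearMap) (by ext; simp)
  obtain ⟨K₁, e₁, he₁⟩ := exists_equiv_prod_of_range_eq
    (d.prodMap (LinearMap.id : K₀ →ₗ[R] K₀)) (e₀.toLinearMap ∘ₗ v) hd'.ker_prodMap_id <| by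
      ext y
      obtain ⟨z, rfl⟩ := e₀.surjective y
      have h1 : z ∈ range v ↔ (e₀ z).1 ∈ range d := by
        rw [hv, hd, LinearMap.mem_ker, LinearMap.mem_ker, he₀]
      rw [range_prodMap, LinearMap.range_id, LinearMap.range_comp, Submodule.mem_prod]
      simpa using h1.symm
  have hK₁ : Module.Projective R K₁ :=
    .of_split (e₁.symm.toLinearMap ∘ₗ inr R (M₁ × K₀) K₁) (snd R (M₁ × K₀) K₁ ∘ₗ e₁.toLinearMap)
      (by ext; simp)
  have hfst (x) : d (e₁ x).1.1 = (e₀ (v x)).1 := congrArg Prod.fst (he₁ x)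
  have hsnd (x) : (e₁ x).1.2 = (e₀ (v x)).2 := congrArg Prod.snd (he₁ x)
  let Φ : Module.Dual R F₁ →ₗ[R] (Module.Dual R M₁ ⧸ range d.dualMap) × Module.Dual R K₁ :=
    ((range d.dualMap).mkQ ∘ₗ
      (e₁.symm.toLinearMap ∘ₗ inl R (M₁ × K₀) K₁ ∘ₗ inl R M₁ K₀).dualMap).prod
    (e₁.symm.toLinearMap ∘ₗ inr R (M₁ × K₀) K₁).dualMap
  have hΦ : Surjective Φ := by
    rintro ⟨χ, κ⟩
    obtain ⟨χ, rfl⟩ := Submodule.mkQ_surjective _ χ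
    refine ⟨(χ ∘ₗ fst R M₁ K₀ ∘ₗ fst R (M₁ × K₀) K₁ + κ ∘ₗ snd R (M₁ × K₀) K₁) ∘ₗ
      e₁.toLinearMap, Prod.ext ?_ ?_⟩
    · refine congrArg (range d.dualMap).mkQ ?_
      ext; simp
    · ext; simp [Φ]
  have hker : ker Φ = range v.dualMap := by
    ext φ
    rw [LinearMap.mem_ker, Prod.ext_iff]
    constructor
    · rintro ⟨h₁, h₂⟩
      obtain ⟨χ, hχ⟩ := (Submodule.Quotient.mk_eq_zero _).1 h₁
      refine ⟨(χ ∘ₗ fst R M₀ K₀ + φ ∘ₗ e₁.symm.toLinearMap ∘ₗ inl R (M₁ × K₀) K₁ ∘ₗ inr R M₁ K₀ ∘ₗ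
        snd R M₀ K₀) ∘ₗ e₀.toLinearMap, ?_⟩
      ext x
      have hχ' := LinearMap.congr_fun hχ (e₁ x).1.1
      have h₂' := LinearMap.congr_fun h₂ (e₁ x).2
      simp only [dualMap_apply, LinearMap.comp_apply, LinearEquiv.coe_coe, LinearMap.add_apply,
        fst_apply, snd_apply, ← hfst, ← hsnd] at hχ' ⊢
      have hx : e₁.symm ((((e₁ x).1.1, 0), 0)) + e₁.symm ((0, (e₁ x).1.2), 0) +
          e₁.symm (0, (e₁ x).2) = x := by
        rw [← map_add, ← map_add, LinearEquiv.symm_apply_eq]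
        ext <;> simp
      have h₂'' : φ (e₁.symm (0, (e₁ x).2)) = 0 := h₂'
      rw [hχ']
      conv_rhs => rw [← hx, map_add, map_add, h₂'', add_zero]
      rfl
    · rintro ⟨ψ, rfl⟩
      have hv' (y) : v (e₁.symm y) = e₀.symm (d y.1.1, y.1.2) := by
        rw [← e₀.symm_apply_apply (v _)]
        refine congrArg e₀.symm (Prod.ext ?_ ?_)
        · rw [← hfst, e₁.apply_symm_apply]
        · rw [← hsnd, e₁.apply_symm_apply]
      refine ⟨(Submodule.Quotient.mk_eq_zero _).2
        ⟨ψ ∘ₗ e₀.symm.toLinearMap ∘ₗ inl R M₀ K₀, ?_⟩, ?_⟩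
      · ext x
        exact congrArg ψ (hv' ((x, 0), 0)).symm
      · ext y
        exact (congrArg ψ (hv' (0, y))).trans (by simp [← Prod.zero_eq_mk])
  exact ⟨K₁, hK₁, ⟨(Submodule.quotEquivOfEq _ _ hker.symm).trans
    (Φ.quotKerEquivOfSurjective hΦ)⟩⟩

/-- The six-term exact sequence of duals and cokernels of dual presentations. -/
lemma exists_dual_snake {P₁ P₀ Q₁ Q₀ A B : Type} [AddCommGroup P₁] [Module R P₁]
    [AddCommGroup P₀] [Module R P₀] [AddCommGroup Q₁] [Module R Q₁] [AddCommGroup Q₀] [Module R Q₀]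
    [AddCommGroup A] [Module R A] [AddCommGroup B] [Module R B]
    {f : A →ₗ[R] B} {dA : P₁ →ₗ[R] P₀} {pA : P₀ →ₗ[R] A} (hpA : Surjective pA)
    (hdA : range dA = ker pA) {dC : Q₁ →ₗ[R] Q₀} {v : P₁ × Q₁ →ₗ[R] P₀ × Q₀} {q : P₀ × Q₀ →ₗ[R] B}
    (hq : Surjective q) (hvq : range v = ker q) (hqi : q ∘ₗ inl R P₀ Q₀ = f ∘ₗ pA)
    (hvi : v ∘ₗ inl R P₁ Q₁ = inl R P₀ Q₀ ∘ₗ dA)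
    (hvs : snd R P₀ Q₀ ∘ₗ v = dC ∘ₗ snd R P₁ Q₁) :
    ∃ (δ : Module.Dual R A →ₗ[R] Module.Dual R Q₁ ⧸ range dC.dualMap)
      (α : (Module.Dual R Q₁ ⧸ range dC.dualMap) →ₗ[R]
        Module.Dual R (P₁ × Q₁) ⧸ range v.dualMap)
      (β : (Module.Dual R (P₁ × Q₁) ⧸ range v.dualMap) →ₗ[R]
        Module.Dual R P₁ ⧸ range dA.dualMap),
      Exact f.dualMap δ ∧ Exact δ α ∧ Exact α β ∧ Surjective β := by
  have hex (X Y : Type) [AddCommGroup X] [Module R X] [AddCommGroup Y] [Module R Y] :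
      Exact (snd R X Y).dualMap (inl R X Y).dualMap :=
    exact_lcomp_of_exact_of_surjective R .inl_snd snd_surjective
  have hinj (X Y : Type) [AddCommGroup X] [Module R X] [AddCommGroup Y] [Module R Y] :
      Injective (snd R X Y).dualMap :=
    dualMap_injective_of_surjective snd_surjective
  have hsurj (X Y : Type) [AddCommGroup X] [Module R X] [AddCommGroup Y] [Module R Y] :
      Surjective (inl R X Y).dualMap := fun φ => ⟨φ ∘ₗ fst R X Y, by ext; simp⟩
  have h₁ : (snd R P₁ Q₁).dualMap ∘ₗ dC.dualMap = v.dualMap ∘ₗ (snd R P₀ Q₀).dualMap := by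
    simp only [dualMap_comp_dualMap, hvs]
  have h₂ : (inl R P₁ Q₁).dualMap ∘ₗ v.dualMap = dA.dualMap ∘ₗ (inl R P₀ Q₀).dualMap := by
    simp only [dualMap_comp_dualMap, hvi]
  have hιA : Exact pA.dualMap dA.dualMap :=
    exact_lcomp_of_exact_of_surjective R (LinearMap.exact_iff.2 hdA.symm) hpA
  have hιB : Exact q.dualMap v.dualMap :=
    exact_lcomp_of_exact_of_surjective R (LinearMap.exact_iff.2 hvq.symm) hq
  have hle₁ : range dC.dualMap ≤ (range v.dualMap).comap (snd R P₁ Q₁).dualMap := by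
    rintro _ ⟨φ, rfl⟩
    exact ⟨_, (LinearMap.congr_fun h₁ φ).symm⟩
  have hle₂ : range v.dualMap ≤ (range dA.dualMap).comap (inl R P₁ Q₁).dualMap := by
    rintro _ ⟨φ, rfl⟩
    exact ⟨_, (LinearMap.congr_fun h₂ φ).symm⟩
  refine ⟨SnakeLemma.δ' dC.dualMap v.dualMap dA.dualMap _ _ (hex P₀ Q₀) _ _ (hex P₁ Q₁) h₁ h₂
      pA.dualMap hιA (range dC.dualMap).mkQ (exact_map_mkQ_range _) (hsurj _ _) (hinj _ _),
    Submodule.mapQ _ _ _ hle₁, Submodule.mapQ _ _ _ hle₂, ?_, ?_, ?_, ?_⟩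
  · exact SnakeLemma.exact_δ'_right dC.dualMap v.dualMap dA.dualMap _ _ (hex P₀ Q₀) _ _ (hex P₁ Q₁)
      h₁ h₂ q.dualMap hιB pA.dualMap hιA (range dC.dualMap).mkQ (exact_map_mkQ_range _)
      (hsurj _ _) (hinj _ _) f.dualMap (by simp only [dualMap_comp_dualMap, hqi])
      (dualMap_injective_of_surjective hpA)
  · apply SnakeLemma.exact_δ'_left (hπ₂ := exact_map_mkQ_range _)
      (h := Submodule.mkQ_surjective _)
    exact Submodule.mapQ_mkQ ..
  · intro x
    obtain ⟨φ, rfl⟩ := Submodule.mkQ_surjective _ x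
    constructor
    · intro h
      obtain ⟨ψ, hψ⟩ := (Submodule.Quotient.mk_eq_zero _).1 h
      obtain ⟨ψ, rfl⟩ := hsurj P₀ Q₀ ψ
      obtain ⟨χ, hχ⟩ := (hex P₁ Q₁ (φ - v.dualMap ψ)).1 (by
        rw [map_sub, ← hψ, sub_eq_zero]
        exact (LinearMap.congr_fun h₂ ψ).symm)
      refine ⟨(range dC.dualMap).mkQ χ, (Submodule.Quotient.eq _).2 ?_⟩
      exact ⟨-ψ, by rw [hχ, map_neg]; abel⟩
    · rintro ⟨y, hy⟩
      obtain ⟨χ, rfl⟩ := Submodule.mkQ_surjective _ y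
      rw [← hy]
      exact congrArg (range dA.dualMap).mkQ ((hex P₁ Q₁).apply_apply_eq_zero χ)
  · intro x
    obtain ⟨φ, rfl⟩ := Submodule.mkQ_surjective _ x
    obtain ⟨ψ, rfl⟩ := hsurj P₁ Q₁ φ
    exact ⟨(range v.dualMap).mkQ ψ, rfl⟩

end Covers


theorem statement8 (R : Type) [CommRing R] [IsNoetherianRing R] [IsLocalRing R]
    (f : MObj R) (h1 : Module.Finite R f.dom.carrier) (h2 : Module.Finite R f.cod.carrier)
    (hmono : Function.Injective f.map) :
    ∃ TA TB TC Q : Mdl R,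
      IsTranspose f.dom TA ∧ IsTranspose f.cod TB ∧ IsTranspose (CokMod f) TC ∧ FGProj Q ∧
      ∃ (δ : Module.Dual R f.dom.carrier →ₗ[R] TC.carrier)
        (α : TC.carrier →ₗ[R] (TB.carrier × Q.carrier))
        (β : (TB.carrier × Q.carrier) →ₗ[R] TA.carrier),
        Function.Injective (LinearMap.range f.map).mkQ.dualMap ∧
        LinearMap.range (LinearMap.range f.map).mkQ.dualMap = LinearMap.ker f.map.dualMap ∧
        LinearMap.range f.map.dualMap = LinearMap.ker δ ∧
        LinearMap.range δ = LinearMap.ker α ∧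
        LinearMap.range α = LinearMap.ker β ∧
        Function.Surjective β := by
  obtain ⟨m, n, dA, pA, hpA, hpA', hdA, hdA'⟩ := exists_minimal_presentation (R := R) f.dom.carrier
  obtain ⟨m', n', dB, pB, hpB, hpB', hdB, hdB'⟩ := exists_minimal_presentation (R := R) f.cod.carrier
  obtain ⟨m'', n'', dC, pC, hpC, hpC', hdC, hdC'⟩ :=
    exists_minimal_presentation (R := R) (f.cod.carrier ⧸ range f.map)
  have hex : Exact f.map (range f.map).mkQ := exact_map_mkQ_range _
  obtain ⟨v, q, hq, hvq, hqi, hvi, hvs⟩ := exists_horseshoe hmono (range f.map).mkQ_surjective hex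
    hpA hdA hpC hdC
  obtain ⟨K, hK, ⟨e⟩⟩ := exists_dual_coker_equiv hpB hq hdB hvq hpB' hdB'
  obtain ⟨δ, α, β, hδ, hα, hβ, hβ'⟩ := exists_dual_snake hpA hdA hq hvq hqi hvi hvs
  have hα' : Exact δ (e.toLinearMap ∘ₗ α) := fun x =>
    (map_eq_zero_iff e e.injective).trans (hα x)
  have hβ₀ : Exact (e.toLinearMap ∘ₗ α) (β ∘ₗ e.symm.toLinearMap) := fun x =>
    (hβ (e.symm x)).trans (exists_congr fun y => e.eq_symm_apply)
  refine ⟨_, _, _, Mdl.of R (Module.Dual R K), isTranspose_of hpA hpA' hdA hdA',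
    isTranspose_of hpB hpB' hdB hdB', isTranspose_of (M := CokMod f) hpC hpC' hdC hdC',
    fgProj_of _, δ, e.toLinearMap ∘ₗ α, β ∘ₗ e.symm.toLinearMap,
    dualMap_injective_of_surjective (range f.map).mkQ_surjective, ?_, ?_, ?_, ?_, ?_⟩
  · exact (exact_lcomp_of_exact_of_surjective R hex
      (range f.map).mkQ_surjective).linearMap_ker_eq.symm
  · exact hδ.linearMap_ker_eq.symm
  · exact hα'.linearMap_ker_eq.symm
  · exact hβ₀.linearMap_ker_eq.symm
  · exact hβ'.comp e.symm.surjective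
end

section
/- Let $R$ be a commutative noetherian local ring and $(A \xrightarrow{f} B)$ an object of $\mathcal{H}$, i.e. $A, B$ are finitely generated Gorenstein projective $R$-modules and $f$ is $R$-linear. Let $p': P \to \mathrm{Cok}(f)$ be a projective cover and $p: P \to B$ a lift of $p'$ along the quotient $B \to \mathrm{Cok}(f)$. Then $[f\ \ p]^t: A \oplus P \to B$ is surjective, and the natural morphism $(1_A \hookrightarrow A\oplus P \text{-component},\ 1_B): f \to [f\ \ p]^t$ is an $\mathcal{E}$-envelope of $f$, where $\mathcal{E}$ is the subcategory of epimorphisms in $\mathcal{H}$. -/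
open LinearMap Function

/-- The direct sum of a Gorenstein projective module and a finitely generated projective module
is Gorenstein projective. -/
theorem IsGP.prod {S : Type} [Ring S] {M P : Mdl S} (hM : IsGP M) (hP : FGProj P) :
    IsGP (Mdl.of S (M.carrier × P.carrier)) := by
  obtain ⟨C, d, hC, hex, hext, ⟨e⟩⟩ := hM
  obtain ⟨hP₁, hP₂⟩ := hP
  -- add to `C` the contractible complex with terms `P × P` and differential `(x, y) ↦ (y, 0)`
  let δ : (P.carrier × P.carrier) →ₗ[S] (P.carrier × P.carrier) :=
    LinearMap.inl S _ _ ∘ₗ LinearMap.snd S _ _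
  refine ⟨fun i => Mdl.of S ((C i).carrier × (P.carrier × P.carrier)),
    fun i => (d i).prodMap δ, fun i => ?_, fun i => ?_, fun Q hQ i g hg => ?_, ⟨?_⟩⟩
  · obtain ⟨h₁, h₂⟩ := hC i
    constructor
    · change Module.Projective S ((C i).carrier × (P.carrier × P.carrier))
      infer_instance
    · change Module.Finite S ((C i).carrier × (P.carrier × P.carrier))
      infer_instance
  · have hδ : LinearMap.range δ = LinearMap.ker δ := by
      ext ⟨x, y⟩
      constructor
      · rintro ⟨⟨u, v⟩, h⟩
        simp_all [δ]
      · intro h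
        refine ⟨(0, x), ?_⟩
        simp_all [δ]
    change LinearMap.range ((d (i + 1)).prodMap δ) = LinearMap.ker ((d i).prodMap δ)
    rw [LinearMap.range_prodMap, LinearMap.ker_prodMap, hex i, hδ]
  · change ((C (i + 1)).carrier × (P.carrier × P.carrier)) →ₗ[S] Q.carrier at g
    change g ∘ₗ (d (i + 1)).prodMap δ = 0 at hg
    obtain ⟨h, hh⟩ := hext Q hQ i (g ∘ₗ LinearMap.inl S _ _) (by
      ext x
      have h : g (d (i + 1) x, δ 0) = 0 := LinearMap.congr_fun hg (x, 0)
      rwa [map_zero] at h)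
    refine ⟨LinearMap.coprod h
      (g ∘ₗ LinearMap.inr S _ _ ∘ₗ LinearMap.inr S _ _ ∘ₗ LinearMap.fst S _ _), ?_⟩
    change _ ∘ₗ (d i).prodMap δ = g
    refine LinearMap.ext fun ⟨c, x, y⟩ => ?_
    have h₁ : h (d i c) = g (c, 0, 0) := LinearMap.congr_fun hh c
    have h₂ : g (0, x, 0) = 0 := by
      simpa [δ] using LinearMap.congr_fun hg (0, 0, x)
    have h₃ : g (c, x, y) = g (c, 0, 0) + g (0, 0, y) + g (0, x, 0) := by
      rw [← map_add, ← map_add]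
      simp
    simp [δ, h₁, h₂, h₃]
  · let k : (M.carrier × P.carrier) →ₗ[S] ((C (0 + 1)).carrier × (P.carrier × P.carrier)) :=
      ((LinearMap.ker (d 0)).subtype ∘ₗ e.toLinearMap).prodMap (LinearMap.inl S _ _)
    have hk : Function.Injective k := by
      rintro ⟨a, b⟩ ⟨a', b'⟩ h
      simpa [k] using h
    have hr : LinearMap.range k = LinearMap.ker ((d 0).prodMap δ) := by
      have hδ : LinearMap.range (LinearMap.inl S P.carrier P.carrier) = LinearMap.ker δ := by
        ext ⟨x, y⟩
        constructor
        · rintro ⟨z, h⟩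
          simp_all [δ]
        · intro h
          refine ⟨x, ?_⟩
          simp_all [δ]
      rw [LinearMap.range_prodMap, LinearMap.ker_prodMap, hδ, LinearMap.range_comp,
        LinearEquiv.range, Submodule.map_top, Submodule.range_subtype]
    exact (LinearEquiv.ofInjective k hk).trans (LinearEquiv.ofEq _ _ hr)

/-- An endomorphism of `P` compatible with a projective cover out of `P` is bijective. -/
theorem IsProjCover.bijective_of_comp_eq {R : Type} [CommRing R] {P M : Mdl R}
    {q : P.carrier →ₗ[R] M.carrier} (hq : IsProjCover q) {t : P.carrier →ₗ[R] P.carrier}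
    (ht : q ∘ₗ t = q) : Function.Bijective t := by
  obtain ⟨⟨-, _⟩, -, hsup⟩ := hq
  have hs : Function.Surjective t := by
    rw [← LinearMap.range_eq_top]
    refine hsup _ (eq_top_iff.2 fun x _ => ?_)
    refine Submodule.mem_sup.2 ⟨t x, ⟨x, rfl⟩, x - t x, ?_, by abel⟩
    have : q (t x) = q x := LinearMap.congr_fun ht x
    simp [this]
  exact ⟨OrzechProperty.injective_of_surjective_endomorphism t hs, hs⟩

theorem statement10 (R : Type) [CommRing R] [IsNoetherianRing R] [IsLocalRing R]
    (f : MObj R) (hH : InH f)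
    (P : Mdl R) (p' : P.carrier →ₗ[R] (CokMod f).carrier) (hp' : IsProjCover p')
    (p : P.carrier →ₗ[R] f.cod.carrier)
    (hlift : (LinearMap.range f.map).mkQ ∘ₗ p = p') :
    Function.Surjective (LinearMap.coprod f.map p) ∧
    ∃ φ : MHom f (⟨Mdl.of R (f.dom.carrier × P.carrier), f.cod,
        LinearMap.coprod f.map p⟩ : MObj R),
      φ.h1 = LinearMap.inl R f.dom.carrier P.carrier ∧ φ.h2 = LinearMap.id ∧
      IsEEnvelope φ := by
  subst hlift
  have hsurj : Function.Surjective (LinearMap.coprod f.map p) := by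
    intro b
    obtain ⟨x, hx⟩ := hp'.2.1 ((LinearMap.range f.map).mkQ b)
    obtain ⟨a, ha⟩ : b - p x ∈ LinearMap.range f.map := by
      rw [← Submodule.Quotient.eq]
      exact hx.symm
    exact ⟨(a, x), by simp [ha]⟩
  refine ⟨hsurj, ⟨LinearMap.inl R _ _, LinearMap.id, ?_⟩, rfl, rfl,
    ⟨⟨⟨hH.1.prod hp'.1, hH.2⟩, hsurj⟩, fun e' he' ψ => ?_⟩, fun ξ h₁ h₂ => ?_⟩
  · exact LinearMap.coprod_inl f.map p
  · have : Module.Projective R P.carrier := hp'.1.1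
    obtain ⟨q, hq⟩ := Module.projective_lifting_property e'.map (ψ.h2 ∘ₗ p) he'.2
    refine ⟨⟨LinearMap.coprod ψ.h1 q, ψ.h2, ?_⟩, LinearMap.coprod_inl _ _,
      LinearMap.comp_id _⟩
    change e'.map ∘ₗ LinearMap.coprod ψ.h1 q = ψ.h2 ∘ₗ LinearMap.coprod f.map p
    rw [LinearMap.comp_coprod, LinearMap.comp_coprod, ψ.comm, hq]
  · obtain ⟨u, v, huv⟩ := ξ
    change (f.dom.carrier × P.carrier) →ₗ[R] (f.dom.carrier × P.carrier) at u
    change u ∘ₗ LinearMap.inl R _ _ = LinearMap.inl R _ _ at h₁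
    change v = LinearMap.id at h₂
    change LinearMap.coprod f.map p ∘ₗ u = v ∘ₗ LinearMap.coprod f.map p at huv
    subst h₂
    refine ⟨?_, Function.bijective_id⟩
    change Function.Bijective u
    let s : P.carrier →ₗ[R] f.dom.carrier := LinearMap.fst R _ _ ∘ₗ u ∘ₗ LinearMap.inr R _ _
    let t : P.carrier →ₗ[R] P.carrier := LinearMap.snd R _ _ ∘ₗ u ∘ₗ LinearMap.inr R _ _
    have hu (a : f.dom.carrier) (x : P.carrier) : u (a, x) = (a + s x, t x) := by
      have h : u (a, 0) = (a, 0) := LinearMap.congr_fun h₁ a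
      have h' : u (a, x) = u (a, 0) + u (0, x) := by rw [← map_add]; simp
      rw [h', h]
      ext <;> simp [s, t]
    have ht : Function.Bijective t := by
      refine hp'.bijective_of_comp_eq (LinearMap.ext fun x => ?_)
      have h : f.map (u (0, x)).1 + p (u (0, x)).2 = p x := by
        simpa using LinearMap.congr_fun huv (0, x)
      refine (Submodule.Quotient.eq (LinearMap.range f.map)).2 ⟨-s x, ?_⟩
      rw [hu] at h
      rw [← h]
      simp
    constructor
    · rintro ⟨a, x⟩ ⟨a', x'⟩ h
      rw [hu, hu, Prod.mk.injEq] at h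
      obtain rfl := ht.1 h.2
      simpa using h.1
    · rintro ⟨a, x⟩
      obtain ⟨y, rfl⟩ := ht.2 x
      exact ⟨(a - s y, y), by simp [hu]⟩
end

section
/- Let $R$ be a commutative noetherian local ring. The duality $(-)' = \mathrm{Hom}_R(-,R)$ on finitely generated Gorenstein projective $R$-modules induces a duality between the subcategories $\mathcal{G}$ (Gorenstein projective objects: monomorphisms with Gorenstein projective domain and cokernel) and $\mathcal{E}$ (epimorphisms between Gorenstein projective modules) of $\mathcal{H}$: for $f \in \mathcal{G}$ and $h \in \mathcal{H}$, a morphism $f \to h$ is a $\mathcal{G}$-cover of $h$ if and only if $h' \to f'$ is an $\mathcal{E}$-envelope of $h'$. -/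
open LinearMap Function

open CategoryTheory Abelian Module

section DualExact

variable {R A B C : Type} [CommRing R] [AddCommGroup A] [Module R A] [AddCommGroup B] [Module R B]
  [AddCommGroup C] [Module R C] {i : A →ₗ[R] B} {p : B →ₗ[R] C}

theorem exact_dualMap_of_exact (hp : Function.Surjective p) (hex : Function.Exact i p) :
    Function.Exact p.dualMap i.dualMap :=
  LinearMap.exact_lcomp_of_exact_of_surjective R hex hp

theorem isReflexive_of_exact_left [IsReflexive R B] (hi : Function.Injective i)
    (hex : Function.Exact i p) (hC : Function.Injective (Dual.eval R C))
    (hext : Function.Surjective i.dualMap) : IsReflexive R A where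
  bijective_dual_eval' := by
    refine ⟨fun a b hab => hi ((bijective_dual_eval R B).1 ?_), fun ξ => ?_⟩
    · ext g
      exact LinearMap.congr_fun hab (i.dualMap g)
    · obtain ⟨b, hb⟩ := (bijective_dual_eval R B).2 (i.dualMap.dualMap ξ)
      have hb' (g : Dual R B) : g b = ξ (i.dualMap g) := LinearMap.congr_fun hb g
      have hpb : p b = 0 := hC <| by
        ext g
        have h0 : i.dualMap (p.dualMap g) = 0 := by
          ext a
          simp [hex.apply_apply_eq_zero]
        simpa [h0] using hb' (p.dualMap g)
      obtain ⟨a, rfl⟩ := (hex b).1 hpb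
      refine ⟨a, ?_⟩
      ext g
      obtain ⟨g, rfl⟩ := hext g
      exact hb' g

theorem isReflexive_of_exact_middle [IsReflexive R A] [IsReflexive R C]
    (hp : Function.Surjective p) (hex : Function.Exact i p)
    (hext : Function.Surjective i.dualMap) : IsReflexive R B where
  bijective_dual_eval' := by
    constructor
    · rw [injective_iff_map_eq_zero]
      intro b hb
      have hpb : p b = 0 := (bijective_dual_eval R C).1 <| by
        ext g
        simpa using LinearMap.congr_fun hb (p.dualMap g)
      obtain ⟨a, rfl⟩ := (hex b).1 hpb
      have ha : a = 0 := (bijective_dual_eval R A).1 <| by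
        ext g
        obtain ⟨g, rfl⟩ := hext g
        simpa using LinearMap.congr_fun hb g
      simp [ha]
    · intro ξ
      obtain ⟨c, hc⟩ := (bijective_dual_eval R C).2 (p.dualMap.dualMap ξ)
      obtain ⟨b, rfl⟩ := hp c
      have hzero (g : Dual R C) : (ξ - Dual.eval R B b) (p.dualMap g) = 0 := by
        have := LinearMap.congr_fun hc g
        simp only [Dual.eval_apply, LinearMap.dualMap_apply'] at this
        simp [this, LinearMap.dualMap_apply']
      obtain ⟨η, hη⟩ := (exact_dualMap_of_exact hext (exact_dualMap_of_exact hp hex)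
        (ξ - Dual.eval R B b)).1 (by ext g; exact hzero g)
      obtain ⟨a, rfl⟩ := (bijective_dual_eval R A).2 η
      refine ⟨i a + b, ?_⟩
      have : Dual.eval R B (i a) = ξ - Dual.eval R B b := hη
      rw [map_add, this, sub_add_cancel]

theorem surjective_dualMap_dualMap [IsReflexive R C] (hp : Function.Surjective p) :
    Function.Surjective p.dualMap.dualMap := by
  intro ξ
  obtain ⟨c, rfl⟩ := (bijective_dual_eval R C).2 ξ
  obtain ⟨b, rfl⟩ := hp c
  exact ⟨Dual.eval R B b, rfl⟩

/-- If all functionals on a finitely generated module extend along `i`, then so do all maps to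
projective modules. -/
theorem exists_extension_of_projective [Module.Finite R A] {Q : Type} [AddCommGroup Q]
    [Module R Q] [Module.Projective R Q] (hext : Function.Surjective i.dualMap)
    (g : A →ₗ[R] Q) : ∃ h : B →ₗ[R] Q, h ∘ₗ i = g := by
  classical
  obtain ⟨s, hs⟩ := Module.projective_def.1 (inferInstance : Module.Projective R Q)
  obtain ⟨S, hS⟩ := Module.Finite.fg_top (R := R) (M := A)
  choose h hh using fun q : Q => hext (Finsupp.lapply q ∘ₗ s ∘ₗ g)
  have hh' (q : Q) (a : A) : h q (i a) = s (g a) q := LinearMap.congr_fun (hh q) a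
  let T : Finset Q := S.biUnion fun a => (s (g a)).support
  refine ⟨∑ q ∈ T, (h q).smulRight q, LinearMap.ext_on_range (v := ((↑) : S → A))
    (by simpa using hS) ?_⟩
  rintro ⟨a, ha⟩
  have hsub : (s (g a)).support ⊆ T := Finset.subset_biUnion_of_mem
    (fun a => (s (g a)).support) ha
  conv_rhs => rw [← hs (g a)]
  rw [Finsupp.linearCombination_apply, Finsupp.sum_of_support_subset _ hsub _ (by simp)]
  simp [hh']

end DualExact

section ExtVanishing

variable (R : Type) [CommRing R]

/-- `Ext^n(M, R)` vanishes for all positive `n`. -/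
def ExtVanishes (M : Type) [AddCommGroup M] [Module R M] : Prop :=
  ∀ (n : ℕ) (x : Ext (ModuleCat.of R M) (ModuleCat.of R R) (n + 1)), x = 0

variable {R} {A B C : Type} [AddCommGroup A] [Module R A] [AddCommGroup B] [Module R B]
  [AddCommGroup C] [Module R C] {i : A →ₗ[R] B} {p : B →ₗ[R] C}

theorem shortExact_of_exact (hi : Function.Injective i) (hp : Function.Surjective p)
    (hex : Function.Exact i p) :
    (ModuleCat.shortComplexOfCompEqZero i p hex.linearMap_comp_eq_zero).ShortExact :=
  ModuleCat.shortComplex_shortExact _ hex hi hp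

theorem extVanishes_of_projective [Module.Projective R A] : ExtVanishes R A := fun _ x =>
  have := (IsProjective.iff_projective (R := R) A).1 inferInstance
  x.eq_zero_of_projective

theorem ExtVanishes.equiv (hA : ExtVanishes R A) (e : A ≃ₗ[R] B) : ExtVanishes R B := by
  intro n x
  have h := hA n ((Ext.mk₀ e.toModuleIso.hom).comp x (zero_add _))
  rw [← Ext.mk₀_id_comp x, ← e.toModuleIso.inv_hom_id, ← Ext.mk₀_comp_mk₀_assoc, h, Ext.comp_zero]

theorem ExtVanishes.middle (hi : Function.Injective i) (hp : Function.Surjective p)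
    (hex : Function.Exact i p) (hA : ExtVanishes R A) (hC : ExtVanishes R C) :
    ExtVanishes R B := by
  intro n x
  obtain ⟨y, rfl⟩ := Ext.contravariant_sequence_exact₂ (shortExact_of_exact hi hp hex) _ x
    (hA n _)
  rw [show y = 0 from hC n y, Ext.comp_zero]

theorem ExtVanishes.left (hi : Function.Injective i) (hp : Function.Surjective p)
    (hex : Function.Exact i p) (hB : ExtVanishes R B) (hC : ExtVanishes R C) :
    ExtVanishes R A := by
  intro n x
  obtain ⟨y, rfl⟩ := Ext.contravariant_sequence_exact₁ (shortExact_of_exact hi hp hex) _ x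
    (add_comm 1 (n + 1)) (hC (n + 1) _)
  rw [show y = 0 from hB n y, Ext.comp_zero]

theorem ext_eq_zero_right_succ (hi : Function.Injective i) (hp : Function.Surjective p)
    (hex : Function.Exact i p) {n : ℕ}
    (hA : ∀ x : Ext (ModuleCat.of R A) (ModuleCat.of R R) (n + 1), x = 0)
    (hB : ExtVanishes R B) (x : Ext (ModuleCat.of R C) (ModuleCat.of R R) (n + 2)) : x = 0 := by
  obtain ⟨y, rfl⟩ := Ext.contravariant_sequence_exact₃ (shortExact_of_exact hi hp hex) _ x
    (hB (n + 1) _) (add_comm 1 (n + 1))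
  rw [show y = 0 from hA y, Ext.comp_zero]

theorem ext_one_eq_zero_right (hi : Function.Injective i) (hp : Function.Surjective p)
    (hex : Function.Exact i p) (hext : Function.Surjective i.dualMap) (hB : ExtVanishes R B)
    (x : Ext (ModuleCat.of R C) (ModuleCat.of R R) 1) : x = 0 := by
  obtain ⟨y, rfl⟩ := Ext.contravariant_sequence_exact₃ (shortExact_of_exact hi hp hex) _ x
    (hB 0 _) (add_comm 1 0)
  obtain ⟨g, rfl⟩ := (Ext.mk₀_bijective _ _).2 y
  obtain ⟨g', hg'⟩ := hext g.hom
  have hg : g = ModuleCat.ofHom i ≫ ModuleCat.ofHom g' := by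
    ext a
    exact (LinearMap.congr_fun hg' a).symm
  rw [hg, ← Ext.mk₀_comp_mk₀]
  exact (shortExact_of_exact hi hp hex).extClass_comp_assoc _

theorem ExtVanishes.right (hi : Function.Injective i) (hp : Function.Surjective p)
    (hex : Function.Exact i p) (hext : Function.Surjective i.dualMap) (hA : ExtVanishes R A)
    (hB : ExtVanishes R B) : ExtVanishes R C
  | 0, x => ext_one_eq_zero_right hi hp hex hext hB x
  | n + 1, x => ext_eq_zero_right_succ hi hp hex (hA n) hB x

theorem ExtVanishes.surjective_dualMap (hi : Function.Injective i) (hp : Function.Surjective p)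
    (hex : Function.Exact i p) (hC : ExtVanishes R C) : Function.Surjective i.dualMap := by
  intro g
  obtain ⟨y, hy⟩ := Ext.contravariant_sequence_exact₁ (shortExact_of_exact hi hp hex)
    (ModuleCat.of R R) (Ext.mk₀ (ModuleCat.ofHom g)) (add_comm 1 0) (hC 0 _)
  obtain ⟨g', rfl⟩ := (Ext.mk₀_bijective _ _).2 y
  rw [Ext.mk₀_comp_mk₀] at hy
  refine ⟨g'.hom, ?_⟩
  ext a
  exact LinearMap.congr_fun (congrArg ModuleCat.Hom.hom ((Ext.mk₀_bijective _ _).1 hy)) a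

end ExtVanishing

section TotallyReflexive

variable (R : Type) [CommRing R]

/-- Totally reflexive modules, in the sense of Auslander and Bridger. -/
structure IsTotallyReflexive (M : Type) [AddCommGroup M] [Module R M] : Prop where
  finite : Module.Finite R M
  reflexive : IsReflexive R M
  ext : ExtVanishes R M
  ext_dual : ExtVanishes R (Dual R M)

variable {R}

theorem finite_dual_of_finite [IsNoetherianRing R] {M : Type} [AddCommGroup M] [Module R M]
    [Module.Finite R M] : Module.Finite R (Dual R M) := by
  obtain ⟨n, p, hp⟩ := Module.Finite.exists_fin' R M
  exact Module.Finite.of_injective p.dualMap (LinearMap.dualMap_injective_of_surjective hp)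

namespace IsTotallyReflexive

theorem of_projective {P : Type} [AddCommGroup P] [Module R P] [Module.Projective R P]
    [Module.Finite R P] : IsTotallyReflexive R P :=
  ⟨inferInstance, inferInstance, extVanishes_of_projective, extVanishes_of_projective⟩

variable {A B C : Type} [AddCommGroup A] [Module R A] [AddCommGroup B] [Module R B]
  [AddCommGroup C] [Module R C] {i : A →ₗ[R] B} {p : B →ₗ[R] C}

theorem equiv (hA : IsTotallyReflexive R A) (e : A ≃ₗ[R] B) : IsTotallyReflexive R B :=
  have := hA.finite
  have := hA.reflexive
  ⟨Module.Finite.equiv e, Module.equiv e, hA.ext.equiv e,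
    hA.ext_dual.equiv e.symm.dualMap⟩

variable [IsNoetherianRing R]

theorem dual (hA : IsTotallyReflexive R A) : IsTotallyReflexive R (Dual R A) :=
  have := hA.finite
  have := hA.reflexive
  ⟨finite_dual_of_finite, inferInstance, hA.ext_dual, hA.ext.equiv (evalEquiv R A)⟩

theorem middle (hi : Function.Injective i) (hp : Function.Surjective p)
    (hex : Function.Exact i p) (hA : IsTotallyReflexive R A) (hC : IsTotallyReflexive R C) :
    IsTotallyReflexive R B := by
  have := hA.finite
  have := hA.reflexive
  have := hC.finite
  have := hC.reflexive
  have hext := hC.ext.surjective_dualMap hi hp hex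
  have : IsNoetherian R B := isNoetherian_of_range_eq_ker i p (LinearMap.exact_iff.1 hex).symm
  exact ⟨inferInstance, isReflexive_of_exact_middle hp hex hext, hA.ext.middle hi hp hex hC.ext,
    hC.ext_dual.middle (LinearMap.dualMap_injective_of_surjective hp) hext
      (exact_dualMap_of_exact hp hex) hA.ext_dual⟩

theorem left (hi : Function.Injective i) (hp : Function.Surjective p)
    (hex : Function.Exact i p) (hB : IsTotallyReflexive R B) (hC : IsTotallyReflexive R C) :
    IsTotallyReflexive R A := by
  have := hB.finite
  have := hB.reflexive
  have := hC.reflexive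
  have hext := hC.ext.surjective_dualMap hi hp hex
  exact ⟨Module.Finite.of_injective i hi,
    isReflexive_of_exact_left hi hex (bijective_dual_eval R C).1 hext,
    hB.ext.left hi hp hex hC.ext,
    hC.ext_dual.right (LinearMap.dualMap_injective_of_surjective hp) hext
      (exact_dualMap_of_exact hp hex) (surjective_dualMap_dualMap hp) hB.ext_dual⟩

end IsTotallyReflexive

/-- `Y` is a syzygy of `X` with respect to a finitely generated projective module. -/
def IsProjSyzygy (X Y : Mdl R) : Prop :=
  ∃ (P : Mdl R) (i : Y.carrier →ₗ[R] P.carrier) (p : P.carrier →ₗ[R] X.carrier), FGProj P ∧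
    Function.Injective i ∧ Function.Surjective p ∧ Function.Exact i p

theorem isTotallyReflexive_of_complete_resolution (K P : ℤ → Mdl R)
    (i : ∀ n, (K (n + 1)).carrier →ₗ[R] (P n).carrier)
    (p : ∀ n, (P n).carrier →ₗ[R] (K n).carrier) (hP : ∀ n, FGProj (P n))
    (hi : ∀ n, Function.Injective (i n)) (hp : ∀ n, Function.Surjective (p n))
    (hex : ∀ n, Function.Exact (i n) (p n)) (hext : ∀ n, Function.Surjective (i n).dualMap)
    (n : ℤ) : IsTotallyReflexive R (K n).carrier := by
  have hproj (n : ℤ) : Module.Projective R (P n).carrier := (hP n).1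
  have hfin (n : ℤ) : Module.Finite R (P n).carrier := (hP n).2
  have hsucc (n : ℤ) : ∃ m, n = m + 1 := ⟨n - 1, by lia⟩
  have heval (n : ℤ) : Function.Injective (Dual.eval R (K n).carrier) := by
    obtain ⟨m, rfl⟩ := hsucc n
    refine fun a b hab => hi m ((bijective_dual_eval R (P m).carrier).1 ?_)
    ext g
    exact LinearMap.congr_fun hab ((i m).dualMap g)
  have hrefl (n : ℤ) : IsReflexive R (K n).carrier := by
    obtain ⟨m, rfl⟩ := hsucc n
    exact isReflexive_of_exact_left (hi m) (hex m) (heval m) (hext m)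
  refine ⟨Module.Finite.of_surjective (p n) (hp n), hrefl n, fun m => ?_, fun m => ?_⟩
  · induction m generalizing n with
    | zero => exact ext_one_eq_zero_right (hi n) (hp n) (hex n) (hext n) extVanishes_of_projective
    | succ m ih =>
      exact ext_eq_zero_right_succ (hi n) (hp n) (hex n) (ih (n + 1)) extVanishes_of_projective
  · have hpd (n : ℤ) := LinearMap.dualMap_injective_of_surjective (hp n)
    have hexd (n : ℤ) := exact_dualMap_of_exact (hp n) (hex n)
    induction m generalizing n with
    | zero =>
      obtain ⟨m, rfl⟩ := hsucc n
      exact ext_one_eq_zero_right (hpd m) (hext m) (hexd m) (surjective_dualMap_dualMap (hp m))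
        extVanishes_of_projective
    | succ k ih =>
      obtain ⟨m, rfl⟩ := hsucc n
      exact ext_eq_zero_right_succ (hpd m) (hext m) (hexd m) (ih m) extVanishes_of_projective

theorem IsGP.isTotallyReflexive {M : Mdl R} (hM : IsGP M) : IsTotallyReflexive R M.carrier := by
  obtain ⟨P, d, hP, hd, hext, ⟨e⟩⟩ := hM
  have hmem (n) (x) : d (n + 1) x ∈ LinearMap.ker (d n) := hd n ▸ LinearMap.mem_range_self _ x
  refine IsTotallyReflexive.equiv ?_ e.symm
  refine isTotallyReflexive_of_complete_resolution (fun n => Mdl.of R (LinearMap.ker (d n)))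
    (fun n => P (n + 1 + 1)) (fun n => (LinearMap.ker (d (n + 1))).subtype)
    (fun n => (d (n + 1)).codRestrict _ (hmem n)) (fun n => hP _)
    (fun n => Subtype.val_injective) (fun n => ?_) (fun n => ?_) (fun n g => ?_) 0
  · rintro ⟨y, hy⟩
    rw [← hd n] at hy
    obtain ⟨x, rfl⟩ := hy
    exact ⟨x, rfl⟩
  · intro x
    exact Subtype.ext_iff.trans ⟨fun h => ⟨⟨x, h⟩, rfl⟩, fun ⟨y, hy⟩ => hy ▸ y.2⟩
  · have : Module.Projective R (Mdl.of R R).carrier := inferInstanceAs (Module.Projective R R)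
    obtain ⟨h, hh⟩ := hext (Mdl.of R R) this (n + 1 + 1)
      (g ∘ₗ (d (n + 1 + 1)).codRestrict _ (hmem (n + 1))) (by
        ext x
        have h0 : (d (n + 1 + 1)).codRestrict _ (hmem (n + 1)) (d (n + 1 + 1 + 1) x) = 0 :=
          Subtype.ext (hmem (n + 1 + 1) x)
        exact (congrArg g h0).trans (map_zero g))
    refine ⟨h, ?_⟩
    ext ⟨y, hy⟩
    obtain ⟨x, rfl⟩ := (hd (n + 1)).symm ▸ hy
    exact LinearMap.congr_fun hh x

variable [IsNoetherianRing R]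

theorem IsTotallyReflexive.exists_isProjSyzygy {M : Type} [AddCommGroup M] [Module R M]
    (hM : IsTotallyReflexive R M) :
    ∃ N : Mdl R, IsTotallyReflexive R N.carrier ∧ IsProjSyzygy (Mdl.of R M) N := by
  have := hM.finite
  obtain ⟨n, p, hp⟩ := Module.Finite.exists_fin' R M
  have hi := (LinearMap.ker p).subtype_injective
  have hex := LinearMap.exact_subtype_ker_map p
  exact ⟨Mdl.of R (LinearMap.ker p), .left hi hp hex .of_projective hM,
    Mdl.of R (Fin n → R), (LinearMap.ker p).subtype, p,
    ⟨inferInstanceAs (Module.Projective R (Fin n → R)),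
      inferInstanceAs (Module.Finite R (Fin n → R))⟩, hi, hp, hex⟩

theorem IsTotallyReflexive.exists_isProjSyzygy_of {M : Type} [AddCommGroup M] [Module R M]
    (hM : IsTotallyReflexive R M) :
    ∃ N : Mdl R, IsTotallyReflexive R N.carrier ∧ IsProjSyzygy N (Mdl.of R M) := by
  have := hM.reflexive
  obtain ⟨N, hN, h⟩ := hM.dual.exists_isProjSyzygy
  obtain ⟨P, i, p, ⟨hP, hP'⟩, hi, hp, hex⟩ : ∃ (P : Mdl R) (i : N.carrier →ₗ[R] P.carrier)
      (p : P.carrier →ₗ[R] Dual R M), FGProj P ∧ Function.Injective i ∧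
        Function.Surjective p ∧ Function.Exact i p := h
  have hinj : Function.Injective (p.dualMap ∘ₗ (evalEquiv R M).toLinearMap) :=
    (LinearMap.dualMap_injective_of_surjective hp).comp (evalEquiv R M).injective
  have hexd : Function.Exact (p.dualMap ∘ₗ (evalEquiv R M).toLinearMap) i.dualMap :=
    (Function.Surjective.comp_exact_iff_exact (evalEquiv R M).surjective).2
      (exact_dualMap_of_exact hp hex)
  exact ⟨Mdl.of R (Dual R N.carrier), hN.dual, Mdl.of R (Dual R P.carrier),
    p.dualMap ∘ₗ (evalEquiv R M).toLinearMap, i.dualMap,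
    ⟨inferInstanceAs (Module.Projective R (Dual R P.carrier)),
      inferInstanceAs (Module.Finite R (Dual R P.carrier))⟩,
    hinj, hM.ext_dual.surjective_dualMap hi hp hex, hexd⟩

end TotallyReflexive

theorem exists_int_chain {α : Type*} (r : α → α → Prop) (hr : ∀ a, ∃ b, r a b)
    (hl : ∀ b, ∃ a, r a b) (a : α) (m : ℤ) : ∃ s : ℤ → α, s m = a ∧ ∀ n, r (s n) (s (n + 1)) := by
  choose next hnext using hr
  choose prev hprev using hl
  let t : ℤ → α := fun n => Int.rec (fun n => next^[n] a) (fun n => prev^[n + 1] a) n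
  have ht (n : ℤ) : r (t n) (t (n + 1)) := by
    match n with
    | .ofNat n =>
      change r (next^[n] a) (next^[n + 1] a)
      rw [Function.iterate_succ_apply']
      exact hnext _
    | .negSucc 0 => exact hprev a
    | .negSucc (n + 1) =>
      change r (prev^[n + 1 + 1] a) (prev^[n + 1] a)
      rw [Function.iterate_succ_apply' prev (n + 1)]
      exact hprev _
  refine ⟨fun n => t (n - m), (congrArg t (sub_self m) : _), fun n => ?_⟩
  have h := ht (n - m)
  rwa [show n - m + 1 = n + 1 - m by lia] at h

theorem isGP_iff_isTotallyReflexive {R : Type} [CommRing R] [IsNoetherianRing R] {M : Mdl R} :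
    IsGP M ↔ IsTotallyReflexive R M.carrier := by
  refine ⟨IsGP.isTotallyReflexive, fun hM => ?_⟩
  obtain ⟨K, hK, hr⟩ := exists_int_chain
    (α := {N : Mdl R // IsTotallyReflexive R N.carrier}) (fun X Y => IsProjSyzygy X.1 Y.1)
    (fun X => have ⟨N, hN, h⟩ := X.2.exists_isProjSyzygy; ⟨⟨N, hN⟩, h⟩)
    (fun X => have ⟨N, hN, h⟩ := X.2.exists_isProjSyzygy_of; ⟨⟨N, hN⟩, h⟩) ⟨M, hM⟩ 2
  choose P i p hP hi hp hex using hr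
  have hker (n) : LinearMap.ker (i n ∘ₗ p (n + 1)) = LinearMap.range (i (n + 1)) := by
    rw [LinearMap.ker_comp_of_ker_eq_bot _ (LinearMap.ker_eq_bot.2 (hi n)),
      LinearMap.exact_iff.1 (hex (n + 1))]
  refine ⟨P, fun n => i n ∘ₗ p (n + 1), hP, fun n => ?_, fun Q hQ n g hg => ?_, ?_⟩
  · rw [hker, LinearMap.range_comp_of_range_eq_top _ (LinearMap.range_eq_top.2 (hp _))]
  · have hg' : g ∘ₗ i (n + 1) = 0 := (LinearMap.cancel_right (hp (n + 1 + 1))).1 <| by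
      rw [LinearMap.zero_comp]
      exact hg
    obtain ⟨g', rfl⟩ :=
      (LinearMap.exact_lcomp_of_exact_of_surjective Q.carrier (hex (n + 1)) (hp (n + 1)) g).1 hg'
    have := (K (n + 1)).2.finite
    obtain ⟨h, rfl⟩ := exists_extension_of_projective
      ((K n).2.ext.surjective_dualMap (hi n) (hp n) (hex n)) g'
    exact ⟨h, rfl⟩
  · rw [hker]
    have (X) (hX : K (0 + 1 + 1) = X) :
        Nonempty (X.1.carrier ≃ₗ[R] LinearMap.range (i (0 + 1))) := by
      subst hX
      exact ⟨LinearEquiv.ofInjective _ (hi _)⟩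
    exact this _ hK

section DualMap

variable {R M N : Type} [CommRing R] [AddCommGroup M] [Module R M] [AddCommGroup N] [Module R N]

theorem exists_dualMap_eq [IsReflexive R N] (θ : Dual R N →ₗ[R] Dual R M) :
    ∃ g : M →ₗ[R] N, g.dualMap = θ := by
  refine ⟨(evalEquiv R N).symm.toLinearMap ∘ₗ θ.dualMap ∘ₗ Dual.eval R M, ?_⟩
  ext ξ m
  simp [LinearMap.dualMap_apply']

theorem dualMap_inj [IsReflexive R N] {g g' : M →ₗ[R] N} : g.dualMap = g'.dualMap ↔ g = g' := by
  refine ⟨fun h => ?_, congrArg _⟩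
  ext m
  apply (bijective_dual_eval R N).1
  ext ξ
  exact LinearMap.congr_fun (LinearMap.congr_fun h ξ) m

theorem bijective_dualMap {g : M →ₗ[R] N} (hg : Function.Bijective g) :
    Function.Bijective g.dualMap :=
  (LinearEquiv.ofBijective g hg).dualMap.bijective

theorem bijective_dualMap_iff [IsReflexive R M] [IsReflexive R N] {g : M →ₗ[R] N} :
    Function.Bijective g.dualMap ↔ Function.Bijective g := by
  refine ⟨fun h => ?_, bijective_dualMap⟩
  have h2 : Function.Bijective (Dual.eval R N ∘ g) :=
    (bijective_dualMap h).comp (bijective_dual_eval R M)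
  exact ((bijective_dual_eval R N).of_comp_iff' _).1 h2

end DualMap

section DualObj

variable {R : Type} [CommRing R] {e f g h : MObj R}

/-- The dual of a morphism in the morphism category. -/
def dualHom (φ : MHom f h) : MHom (DualObj h) (DualObj f) where
  h1 := φ.h2.dualMap
  h2 := φ.h1.dualMap
  comm := (congrArg LinearMap.dualMap φ.comm).symm

theorem exists_dualHom_eq (h₁ : IsReflexive R h.dom.carrier) (h₂ : IsReflexive R h.cod.carrier)
    (θ : MHom (DualObj h) (DualObj f)) : ∃ φ : MHom f h, dualHom φ = θ := by
  obtain ⟨θ₁, θ₂, hθ⟩ := θ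
  obtain ⟨a, rfl⟩ := exists_dualMap_eq (R := R) (M := f.dom.carrier) (N := h.dom.carrier) θ₂
  obtain ⟨b, rfl⟩ := exists_dualMap_eq (R := R) (M := f.cod.carrier) (N := h.cod.carrier) θ₁
  exact ⟨⟨a, b, dualMap_inj.1 hθ.symm⟩, rfl⟩

theorem dualHom_comp_eq_iff (h₁ : IsReflexive R h.dom.carrier)
    (h₂ : IsReflexive R h.cod.carrier) (φ : MHom f h) (ξ : MHom g f) (a : MHom g h) :
    ((dualHom ξ).h1 ∘ₗ (dualHom φ).h1 = (dualHom a).h1 ∧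
      (dualHom ξ).h2 ∘ₗ (dualHom φ).h2 = (dualHom a).h2) ↔
    (φ.h1 ∘ₗ ξ.h1 = a.h1 ∧ φ.h2 ∘ₗ ξ.h2 = a.h2) :=
  and_comm.trans (and_congr (dualMap_inj (g := φ.h1 ∘ₗ ξ.h1) (g' := a.h1))
    (dualMap_inj (g := φ.h2 ∘ₗ ξ.h2) (g' := a.h2)))

theorem mRightMin_iff_mLeftMin_dualHom (hf : InH f) (hh : InH h) (φ : MHom f h) :
    MRightMin φ ↔ MLeftMin (dualHom φ) := by
  have hf₁ := hf.1.isTotallyReflexive.reflexive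
  have hf₂ := hf.2.isTotallyReflexive.reflexive
  have hiff := fun ξ : MHom f f => dualHom_comp_eq_iff hh.1.isTotallyReflexive.reflexive
    hh.2.isTotallyReflexive.reflexive φ ξ φ
  refine ⟨fun H ξ h1 h2 => ?_, fun H ξ h1 h2 => ?_⟩
  · obtain ⟨ξ, rfl⟩ := exists_dualHom_eq hf₁ hf₂ ξ
    obtain ⟨h1, h2⟩ := (hiff ξ).1 ⟨h1, h2⟩
    obtain ⟨b1, b2⟩ := H ξ h1 h2
    exact ⟨bijective_dualMap b2, bijective_dualMap b1⟩
  · obtain ⟨h1, h2⟩ := (hiff ξ).2 ⟨h1, h2⟩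
    obtain ⟨b2, b1⟩ := H (dualHom ξ) h1 h2
    exact ⟨bijective_dualMap_iff.1 b1, bijective_dualMap_iff.1 b2⟩

variable [IsNoetherianRing R]

theorem InH.dualObj (hf : InH f) : InH (DualObj f) :=
  ⟨isGP_iff_isTotallyReflexive.2 hf.2.isTotallyReflexive.dual,
    isGP_iff_isTotallyReflexive.2 hf.1.isTotallyReflexive.dual⟩

theorem InG.inH (hf : InG f) : InH f := by
  obtain ⟨hi, hA, hC⟩ := hf
  exact ⟨hA, isGP_iff_isTotallyReflexive.2 <| .middle hi (Submodule.mkQ_surjective _)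
    (LinearMap.exact_map_mkQ_range f.map) hA.isTotallyReflexive hC.isTotallyReflexive⟩

theorem InG.inE_dualObj (hf : InG f) : InE (DualObj f) :=
  ⟨hf.inH.dualObj, hf.2.2.isTotallyReflexive.ext.surjective_dualMap hf.1
    (Submodule.mkQ_surjective _) (LinearMap.exact_map_mkQ_range f.map)⟩

theorem InE.inG_dualObj (he : InE e) : InG (DualObj e) := by
  obtain ⟨he, hp⟩ := he
  have hi := (LinearMap.ker e.map).subtype_injective
  have hex := LinearMap.exact_subtype_ker_map e.map
  have hC := he.2.isTotallyReflexive
  have hK := IsTotallyReflexive.left hi hp hex he.1.isTotallyReflexive hC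
  have hres := hC.ext.surjective_dualMap hi hp hex
  have hker := LinearMap.exact_iff.1 (exact_dualMap_of_exact hp hex)
  refine ⟨LinearMap.dualMap_injective_of_surjective hp, he.dualObj.1,
    isGP_iff_isTotallyReflexive.2 (hK.dual.equiv ?_)⟩
  exact ((Submodule.quotEquivOfEq _ _ hker.symm).trans
    (LinearMap.quotKerEquivOfSurjective _ hres)).symm

theorem isGPrecover_iff_isEPreenvelope_dualHom (hf : InG f) (hh : InH h) (φ : MHom f h) :
    IsGPrecover φ ↔ IsEPreenvelope (dualHom φ) := by
  have hf₁ := hf.inH.1.isTotallyReflexive.reflexive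
  have hf₂ := hf.inH.2.isTotallyReflexive.reflexive
  have hh₁ := hh.1.isTotallyReflexive.reflexive
  have hh₂ := hh.2.isTotallyReflexive.reflexive
  refine ⟨fun H => ⟨hf.inE_dualObj, fun e he χ => ?_⟩, fun H => ⟨hf, fun g hg a => ?_⟩⟩
  · have he₁ := he.1.1.isTotallyReflexive.reflexive
    have he₂ := he.1.2.isTotallyReflexive.reflexive
    let ε₁ := evalEquiv R e.dom.carrier
    let ε₂ := evalEquiv R e.cod.carrier
    let χ' : MHom (DualObj h) (DualObj (DualObj e)) :=
      ⟨ε₁.toLinearMap ∘ₗ χ.h1, ε₂.toLinearMap ∘ₗ χ.h2, congrArg (ε₂.toLinearMap ∘ₗ ·) χ.comm⟩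
    obtain ⟨a, ha⟩ := exists_dualHom_eq hh₁ hh₂ χ'
    obtain ⟨ξ, hξ⟩ := H.2 _ he.inG_dualObj a
    obtain ⟨hξ1, hξ2⟩ := (dualHom_comp_eq_iff hh₁ hh₂ φ ξ a).2 hξ
    rw [ha] at hξ1 hξ2
    have hε : ε₂.toLinearMap ∘ₗ e.map = (DualObj (DualObj e)).map ∘ₗ ε₁.toLinearMap := rfl
    refine ⟨⟨ε₁.symm.toLinearMap ∘ₗ (dualHom ξ).h1, ε₂.symm.toLinearMap ∘ₗ (dualHom ξ).h2, ?_⟩,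
      ?_, ?_⟩
    · ext x
      apply ε₂.injective
      refine (LinearMap.congr_fun hε (ε₁.symm ((dualHom ξ).h1 x))).trans ?_
      refine (congrArg (DualObj (DualObj e)).map (ε₁.apply_symm_apply _)).trans ?_
      exact (LinearMap.congr_fun (dualHom ξ).comm x).trans (ε₂.apply_symm_apply _).symm
    · ext x
      exact ε₁.symm_apply_eq.2 (LinearMap.congr_fun hξ1 x)
    · ext x
      exact ε₂.symm_apply_eq.2 (LinearMap.congr_fun hξ2 x)
  · obtain ⟨ξ, hξ⟩ := H.2 _ hg.inE_dualObj (dualHom a)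
    obtain ⟨ξ, rfl⟩ := exists_dualHom_eq hf₁ hf₂ ξ
    exact ⟨ξ, (dualHom_comp_eq_iff hh₁ hh₂ φ ξ a).1 hξ⟩

end DualObj

theorem statement12 (R : Type) [CommRing R] [IsNoetherianRing R] [IsLocalRing R]
    (f h : MObj R) (hf : InG f) (hh : InH h)
    (φ : MHom f h) (ψ : MHom (DualObj h) (DualObj f))
    (hψ1 : ψ.h1 = φ.h2.dualMap) (hψ2 : ψ.h2 = φ.h1.dualMap) :
    IsGCover φ ↔ IsEEnvelope ψ := by
  obtain rfl : ψ = dualHom φ := by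
    cases ψ
    simp only at hψ1 hψ2
    subst hψ1 hψ2
    rfl
  exact and_congr (isGPrecover_iff_isEPreenvelope_dualHom hf hh φ)
    (mRightMin_iff_mLeftMin_dualHom hf.inH hh φ)
end

section
/- Let $R$ be a complete commutative noetherian local ring and let $0 \to A \xrightarrow{f} B \xrightarrow{g} C \to 0$ be a short exact sequence of finitely generated Gorenstein projective $R$-modules. Then the endomorphism ring of $f$ as an object of $\mathcal{H}$ is local if and only if the endomorphism ring of $g$ as an object of $\mathcal{H}$ is local. -/
open LinearMap Function

section ShortExact

variable {R A B C : Type*} [Ring R] [AddCommGroup A] [AddCommGroup B] [AddCommGroup C]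
  [Module R A] [Module R B] [Module R C] {f : A →ₗ[R] B} {g : B →ₗ[R] C}

theorem exists_endo_kernel (hf : Injective f) (hex : LinearMap.range f = LinearMap.ker g)
    {β : B →ₗ[R] B} {γ : C →ₗ[R] C} (h : g ∘ₗ β = γ ∘ₗ g) :
    ∃ α : A →ₗ[R] A, f ∘ₗ α = β ∘ₗ f := by
  have hr : ∀ a, (β ∘ₗ f) a ∈ LinearMap.range f := by
    intro a
    have hfa : g (f a) = 0 := LinearMap.mem_ker.1 (hex ▸ LinearMap.mem_range_self f a)
    rw [hex, LinearMap.mem_ker]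
    simpa [hfa] using LinearMap.congr_fun h (f a)
  refine ⟨(LinearEquiv.ofInjective f hf).symm.toLinearMap ∘ₗ
    (β ∘ₗ f).codRestrict (LinearMap.range f) hr, LinearMap.ext fun a => ?_⟩
  exact congrArg Subtype.val ((LinearEquiv.ofInjective f hf).apply_symm_apply
    ((β ∘ₗ f).codRestrict (LinearMap.range f) hr a))

theorem exists_endo_cokernel (hg : Surjective g) (hex : LinearMap.range f = LinearMap.ker g)
    {α : A →ₗ[R] A} {β : B →ₗ[R] B} (h : f ∘ₗ α = β ∘ₗ f) :
    ∃ γ : C →ₗ[R] C, g ∘ₗ β = γ ∘ₗ g := by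
  have hk : LinearMap.ker g ≤ LinearMap.ker (g ∘ₗ β) := by
    rw [← hex]
    rintro _ ⟨a, rfl⟩
    have hβ : β (f a) = f (α a) := (LinearMap.congr_fun h a).symm
    rw [LinearMap.mem_ker, LinearMap.comp_apply, hβ, ← LinearMap.mem_ker, ← hex]
    exact LinearMap.mem_range_self f _
  refine ⟨(LinearMap.ker g).liftQ (g ∘ₗ β) hk ∘ₗ
    (g.quotKerEquivOfSurjective hg).symm.toLinearMap, LinearMap.ext fun b => ?_⟩
  have hb : (g.quotKerEquivOfSurjective hg).symm (g b) = (LinearMap.ker g).mkQ b :=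
    (LinearEquiv.symm_apply_eq _).2 rfl
  simp [hb]

theorem bijective_endo_iff (hf : Injective f) (hg : Surjective g)
    (hex : LinearMap.range f = LinearMap.ker g) {α : A →ₗ[R] A} {β : B →ₗ[R] B} {γ : C →ₗ[R] C}
    (h₁ : f ∘ₗ α = β ∘ₗ f) (h₂ : g ∘ₗ β = γ ∘ₗ g) :
    Bijective α ∧ Bijective β ↔ Bijective β ∧ Bijective γ := by
  have e₁ : ∀ a, f (α a) = β (f a) := LinearMap.congr_fun h₁
  have e₂ : ∀ b, g (β b) = γ (g b) := LinearMap.congr_fun h₂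
  have gf : ∀ a, g (f a) = 0 := fun a =>
    LinearMap.mem_ker.1 (hex ▸ LinearMap.mem_range_self f a)
  have lift : ∀ b, g b = 0 → ∃ a, f a = b := fun b hb =>
    LinearMap.mem_range.1 (hex ▸ LinearMap.mem_ker.2 hb)
  constructor
  · rintro ⟨hα, hβ⟩
    refine ⟨hβ, (injective_iff_map_eq_zero γ).2 fun c hc => ?_, fun c => ?_⟩
    · obtain ⟨b, rfl⟩ := hg c
      obtain ⟨a, ha⟩ := lift (β b) (by rw [e₂, hc])
      obtain ⟨a', rfl⟩ := hα.2 a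
      rw [e₁] at ha
      rw [← hβ.1 ha, gf]
    · obtain ⟨b, rfl⟩ := hg c
      obtain ⟨b', rfl⟩ := hβ.2 b
      exact ⟨g b', (e₂ b').symm⟩
  · rintro ⟨hβ, hγ⟩
    refine ⟨⟨fun a a' h => hf (hβ.1 ?_), fun a => ?_⟩, hβ⟩
    · rw [← e₁, ← e₁, h]
    · obtain ⟨b, hb⟩ := hβ.2 (f a)
      obtain ⟨a', rfl⟩ := lift b (hγ.1 (by rw [← e₂, hb, gf, map_zero]))
      exact ⟨a', hf (by rw [e₁, hb])⟩

theorem comp_id_sub {f : A →ₗ[R] B} {α : A →ₗ[R] A} {β : B →ₗ[R] B} (h : f ∘ₗ α = β ∘ₗ f) :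
    f ∘ₗ (LinearMap.id - α) = (LinearMap.id - β) ∘ₗ f := by
  rw [LinearMap.comp_sub, LinearMap.sub_comp, h, LinearMap.comp_id, LinearMap.id_comp]

end ShortExact

theorem statement13 (R : Type) [CommRing R] [IsNoetherianRing R] [IsLocalRing R]
    [IsAdicComplete (IsLocalRing.maximalIdeal R) R]
    (A B C : Mdl R) (hA : IsGP A) (hB : IsGP B) (hC : IsGP C)
    (fm : A.carrier →ₗ[R] B.carrier) (gm : B.carrier →ₗ[R] C.carrier)
    (hmono : Function.Injective fm) (hepi : Function.Surjective gm)
    (hex : LinearMap.range fm = LinearMap.ker gm) :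
    MEndLocal (⟨A, B, fm⟩ : MObj R) ↔ MEndLocal (⟨B, C, gm⟩ : MObj R) := by
  have key : ∀ {α : A.carrier →ₗ[R] A.carrier} {β : B.carrier →ₗ[R] B.carrier}
      {γ : C.carrier →ₗ[R] C.carrier}, fm ∘ₗ α = β ∘ₗ fm → gm ∘ₗ β = γ ∘ₗ gm →
      (Bijective α ∧ Bijective β ↔ Bijective β ∧ Bijective γ) :=
    bijective_endo_iff hmono hepi hex
  refine and_congr (not_congr ?_) ⟨?_, ?_⟩
  · exact ⟨fun h => ⟨h.2, @Surjective.subsingleton _ _ _ h.2 hepi⟩,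
      fun h => ⟨@Injective.subsingleton _ _ _ hmono h.1, h.1⟩⟩
  · rintro h ⟨β, γ, h₂⟩
    obtain ⟨α, h₁⟩ := exists_endo_kernel hmono hex h₂
    exact (h ⟨α, β, h₁⟩).imp (key h₁ h₂).1 (key (comp_id_sub h₁) (comp_id_sub h₂)).1
  · rintro h ⟨α, β, h₁⟩
    obtain ⟨γ, h₂⟩ := exists_endo_cokernel hepi hex h₁
    exact (h ⟨β, γ, h₂⟩).imp (key h₁ h₂).2 (key (comp_id_sub h₁) (comp_id_sub h₂)).2
end
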